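/- arXiv:1802.10173 — 8 statements merged into one kernel-verified Lean document; each statement's English description precedes it below -/
import Mathlib

section
/- Let f be a homogeneous polynomial of degree d ≥ 1 in the variables x_1,…,x_{n+1} over ℂ, and let A be a real orthogonal (n+1)×(n+1) matrix (AᵀA = I), acting ℂ-linearly on ℂ^{n+1} via its entries. Let g be the homogeneous polynomial defined by g(x) = f(Ax) for all x ∈ ℂ^{n+1}. Then the set of E-eigenvalues of g equals the set of E-eigenvalues of f; more precisely, (λ,x) is an E-eigenpair of f if and only if (λ, Aᵀx) is an E-eigenpair of g. -/
open MvPolynomial Matrix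

theorem chain_aux {m : ℕ} (B : Matrix (Fin m) (Fin m) ℂ) (k : Fin m) (x : Fin m → ℂ)
    (p : MvPolynomial (Fin m) ℂ) :
    eval x (pderiv k (bind₁ (fun i => ∑ j, C (B i j) * X j) p))
      = ∑ i, B i k * eval (fun i => ∑ j, B i j * x j) (pderiv i p) := by
  induction p using MvPolynomial.induction_on with
  | C a => simp
  | add p q hp hq =>
    simp only [map_add, hp, hq, mul_add, Finset.sum_add_distrib]
  | mul_X p i hp =>
    have e : eval x (bind₁ (fun i => ∑ j, C (B i j) * X j) p)
        = eval (fun i => ∑ j, B i j * x j) p := by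
      rw [← MvPolynomial.coe_aeval_eq_eval, ← MvPolynomial.coe_aeval_eq_eval]
      simp only [RingHom.coe_coe, aeval_bind₁]
      simp
    have h1 : eval x (pderiv k (∑ j, C (B i j) * X j)) = B i k := by
      simp [pderiv_X, Pi.single_apply, apply_ite]
    have h2 : eval x (∑ j, C (B i j) * X j) = ∑ j, B i j * x j := by simp
    simp only [map_mul, bind₁_X_right, Derivation.leibniz, smul_eq_mul, map_add, e, h1, h2, hp,
      eval_X, mul_add, Finset.sum_add_distrib]
    congr 1
    · simp [pderiv_X, Pi.single_apply, apply_ite, mul_comm]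
    · rw [Finset.mul_sum]
      exact Finset.sum_congr rfl fun _ _ => by ring

/-- The set of E-eigenvalues of a homogeneous polynomial is invariant under real
orthogonal changes of coordinates: if `g(x) = f(Ax)` with `AᵀA = I`, then the
E-eigenvalues of `g` equal those of `f`, and more precisely `(λ, x)` is an
E-eigenpair of `f` iff `(λ, Aᵀx)` is an E-eigenpair of `g`. -/
theorem eigenpairs_orthogonal_invariance
    (n d : ℕ) (hd : 1 ≤ d)
    (f g : MvPolynomial (Fin (n + 1)) ℂ) (hf : f.IsHomogeneous d)
    (A : Matrix (Fin (n + 1)) (Fin (n + 1)) ℝ)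
    (hA : Aᵀ * A = 1)
    (hg : ∀ x : Fin (n + 1) → ℂ,
      eval x g = eval (fun i => ∑ j, (A i j : ℂ) * x j) f) :
    ({lam : ℂ | ∃ x : Fin (n + 1) → ℂ, (∑ i, (x i) ^ 2 = 1) ∧
        ∀ i, eval x (pderiv i g) = (d : ℂ) * lam * x i}
      = {lam : ℂ | ∃ x : Fin (n + 1) → ℂ, (∑ i, (x i) ^ 2 = 1) ∧
        ∀ i, eval x (pderiv i f) = (d : ℂ) * lam * x i}) ∧
    (∀ (lam : ℂ) (x : Fin (n + 1) → ℂ),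
      ((∑ i, (x i) ^ 2 = 1) ∧ ∀ i, eval x (pderiv i f) = (d : ℂ) * lam * x i)
      ↔ ((∑ i, ((fun k => ∑ j, (A j k : ℂ) * x j) i) ^ 2 = 1) ∧
        ∀ i, eval (fun k => ∑ j, (A j k : ℂ) * x j) (pderiv i g)
          = (d : ℂ) * lam * (fun k => ∑ j, (A j k : ℂ) * x j) i)) := by
  classical
  set B : Matrix (Fin (n + 1)) (Fin (n + 1)) ℂ := A.map (fun r => (r : ℂ)) with hB
  have hBB : Bᵀ * B = 1 := by
    have := congrArg (fun M : Matrix _ _ ℝ => M.map (Complex.ofRealHom)) hA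
    simp [Matrix.map_mul, Matrix.transpose_map] at this
    exact this
  have hBB' : B * Bᵀ = 1 := mul_eq_one_comm.mp hBB
  have hgf : g = bind₁ (fun i => ∑ j, C (B i j) * X j) f := by
    apply MvPolynomial.funext
    intro x
    rw [hg, ← MvPolynomial.coe_aeval_eq_eval, ← MvPolynomial.coe_aeval_eq_eval]
    simp only [RingHom.coe_coe, aeval_bind₁]
    simp [hB]
  have grad : ∀ x : Fin (n + 1) → ℂ, (fun k => eval x (pderiv k g))
      = Bᵀ *ᵥ (fun i => eval (B *ᵥ x) (pderiv i f)) := by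
    intro x
    funext k
    rw [hgf, chain_aux]
    rfl
  have key : ∀ (lam : ℂ) (x : Fin (n + 1) → ℂ),
      ((∑ i, (x i) ^ 2 = 1) ∧ ∀ i, eval x (pderiv i f) = (d : ℂ) * lam * x i)
      ↔ ((∑ i, ((Bᵀ *ᵥ x) i) ^ 2 = 1) ∧
        ∀ i, eval (Bᵀ *ᵥ x) (pderiv i g) = (d : ℂ) * lam * (Bᵀ *ᵥ x) i) := by
    intro lam x
    have hn : ∑ i, ((Bᵀ *ᵥ x) i) ^ 2 = ∑ i, (x i) ^ 2 := by
      have : (Bᵀ *ᵥ x) ⬝ᵥ (Bᵀ *ᵥ x) = x ⬝ᵥ x := by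
        rw [Matrix.dotProduct_mulVec, Matrix.vecMul_transpose, Matrix.mulVec_mulVec, hBB',
          Matrix.one_mulVec]
      simpa [dotProduct, sq] using this
    have hgr := grad (Bᵀ *ᵥ x)
    rw [Matrix.mulVec_mulVec, hBB', Matrix.one_mulVec] at hgr
    rw [hn]
    refine and_congr_right fun _ => ?_
    have e1 : (∀ i, eval x (pderiv i f) = (d : ℂ) * lam * x i) ↔
        (fun i => eval x (pderiv i f)) = ((d : ℂ) * lam) • x := by
      rw [_root_.funext_iff]; rfl
    have e2 : (∀ i, eval (Bᵀ *ᵥ x) (pderiv i g) = (d : ℂ) * lam * (Bᵀ *ᵥ x) i) ↔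
        (fun i => eval (Bᵀ *ᵥ x) (pderiv i g)) = ((d : ℂ) * lam) • (Bᵀ *ᵥ x) := by
      rw [_root_.funext_iff]; rfl
    rw [e1, e2, hgr, ← Matrix.mulVec_smul]
    constructor
    · intro h; rw [h]
    · intro h
      have := congrArg (fun v => B *ᵥ v) h
      simpa only [Matrix.mulVec_mulVec, hBB', Matrix.one_mulVec] using this
  refine ⟨?_, fun lam x => key lam x⟩
  ext lam
  constructor
  · rintro ⟨x, hx⟩
    refine ⟨B *ᵥ x, (key lam (B *ᵥ x)).2 ?_⟩
    rw [Matrix.mulVec_mulVec, hBB, Matrix.one_mulVec]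
    exact hx
  · rintro ⟨x, hx⟩
    exact ⟨Bᵀ *ᵥ x, (key lam x).1 hx⟩
end

section
/- Let d ≥ 3 be odd and let f be a homogeneous polynomial of degree d in the variables x_1,…,x_{n+1} over ℂ which is regular, i.e. there is no nonzero x ∈ ℂ^{n+1} with Σ_i x_i² = 0 and ∂f/∂x_i(x) = 0 for all i. If λ ∈ ℂ is such that the homogeneous system x_0² = Σ_j x_j², ∂f/∂x_i(x) = d·λ·x_0^{d-2}·x_i (i = 1,…,n+1) has a solution (x_0,x) ∈ ℂ × ℂ^{n+1} with (x_0,x) ≠ (0,0), then λ is an E-eigenvalue of f, i.e. there exists y ∈ ℂ^{n+1} with Σ_i y_i² = 1 and ∂f/∂x_i(y) = d·λ·y_i for all i. -/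
open MvPolynomial

lemma eval_scale_aux {n m : ℕ} {g : MvPolynomial (Fin (n + 1)) ℂ} (hg : g.IsHomogeneous m)
    (c : ℂ) (x : Fin (n + 1) → ℂ) :
    eval (fun i => c * x i) g = c ^ m * eval x g := by
  rw [eval_eq, eval_eq, Finset.mul_sum]
  refine Finset.sum_congr rfl fun e he => ?_
  have h := hg (mem_support_iff.mp he)
  rw [Finsupp.weight_apply, Finsupp.sum_fintype _ _ (by simp)] at h
  simp at h
  have h2 : ∑ i ∈ e.support, e i = m := by
    rw [← h]
    exact Finset.sum_subset (Finset.subset_univ _) (by simp)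
  simp_rw [mul_pow]
  rw [Finset.prod_mul_distrib, Finset.prod_pow_eq_pow_sum, h2]
  ring

/-- For a regular homogeneous polynomial `f` of odd degree `d ≥ 3`, every root of the
E-characteristic polynomial is an E-eigenvalue: if the homogenized system
`x₀² = ∑ xⱼ²`, `∇f(x) = d·λ·x₀^(d-2)·x` has a nonzero solution `(x₀, x)`,
then `λ` is an E-eigenvalue of `f`. -/
theorem root_is_eigenvalue_odd
    (n d : ℕ) (hd_odd : Odd d) (hd : 3 ≤ d)
    (f : MvPolynomial (Fin (n + 1)) ℂ) (hf : f.IsHomogeneous d)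
    (hreg : ¬ ∃ x : Fin (n + 1) → ℂ, x ≠ 0 ∧ (∑ i, (x i) ^ 2 = 0) ∧
      ∀ i, eval x (pderiv i f) = 0)
    (lam : ℂ)
    (hsol : ∃ (x0 : ℂ) (x : Fin (n + 1) → ℂ), ¬ (x0 = 0 ∧ x = 0) ∧
      x0 ^ 2 = (∑ j, (x j) ^ 2) ∧
      ∀ i, eval x (pderiv i f) = (d : ℂ) * lam * x0 ^ (d - 2) * x i) :
    ∃ y : Fin (n + 1) → ℂ, (∑ i, (y i) ^ 2 = 1) ∧
      ∀ i, eval y (pderiv i f) = (d : ℂ) * lam * y i := by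
  obtain ⟨x0, x, hne, hq, hx⟩ := hsol
  have h0 : x0 ≠ 0 := by
    rintro rfl
    refine hreg ⟨x, fun h => hne ⟨rfl, h⟩, ?_, fun i => ?_⟩
    · rw [← hq]; simp
    · rw [hx i, zero_pow (by omega)]; simp
  refine ⟨fun i => x0⁻¹ * x i, ?_, fun i => ?_⟩
  · simp_rw [mul_pow]
    rw [← Finset.mul_sum, ← hq]
    field_simp
  · rw [eval_scale_aux (hf.pderiv (i := i)), hx i]
    obtain ⟨k, rfl⟩ : ∃ k, d = k + 2 := ⟨d - 2, by omega⟩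
    have e1 : k + 2 - 1 = k + 1 := by omega
    have e2 : k + 2 - 2 = k := by omega
    rw [e1, e2, pow_succ, inv_pow]
    field_simp
end

section
/- For all integers n ≥ 1 and all k with 0 ≤ k ≤ n-1, the following identity holds in ℤ: Σ_{j=0}^{n-1-k} C(n+1,j)·(-1)^j·2^{n-1-k-j} = Σ_{j=0}^{n-1-k} C(k+j+1,j)·(-1)^j, where C(a,b) denotes the binomial coefficient. -/
open Finset

def auxA (N : ℕ) : ℕ → ℤ
  | 0 => 1
  | m + 1 => 2 * auxA N m + (-1) ^ (m + 1) * (N.choose (m + 1) : ℤ)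

lemma auxA_sum (N m : ℕ) :
    (∑ j ∈ Finset.range (m + 1), (N.choose j : ℤ) * (-1) ^ j * 2 ^ (m - j)) = auxA N m := by
  induction m with
  | zero => simp [auxA]
  | succ m ih =>
    rw [Finset.sum_range_succ, auxA, ← ih, Finset.mul_sum]
    congr 1
    · refine Finset.sum_congr rfl fun j hj => ?_
      have hj' : j < m + 1 := Finset.mem_range.mp hj
      have h : m + 1 - j = (m - j) + 1 := by omega
      rw [h, pow_succ]
      ring
    · simp
      ring

lemma auxA_pascal (N m : ℕ) : auxA (N + 1) (m + 1) = auxA N (m + 1) - auxA N m := by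
  induction m with
  | zero => simp [auxA]; ring
  | succ m ih =>
    rw [auxA, ih, Nat.choose_succ_succ N (m + 1)]
    simp only [auxA, Nat.succ_eq_add_one]
    push_cast
    ring

lemma auxA_eq (k m : ℕ) :
    auxA (m + k + 2) m = ∑ j ∈ Finset.range (m + 1), ((k + j + 1).choose j : ℤ) * (-1) ^ j := by
  induction m with
  | zero => simp [auxA]
  | succ m ih =>
    rw [Finset.sum_range_succ, ← ih, show m + 1 + k + 2 = (m + k + 2) + 1 by ring, auxA_pascal,
      auxA, show k + (m + 1) + 1 = m + k + 2 by ring]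
    ring

/-- For `n ≥ 1` and `0 ≤ k ≤ n-1`,
`∑_{j=0}^{n-1-k} C(n+1,j)·(-1)^j·2^(n-1-k-j) = ∑_{j=0}^{n-1-k} C(k+j+1,j)·(-1)^j`. -/
theorem alpha_eq_beta_binomial_identity
    (n k : ℕ) (hn : 1 ≤ n) (hk : k ≤ n - 1) :
    (∑ j ∈ Finset.range (n - 1 - k + 1),
        ((n + 1).choose j : ℤ) * (-1) ^ j * 2 ^ (n - 1 - k - j))
      = ∑ j ∈ Finset.range (n - 1 - k + 1),
        ((k + j + 1).choose j : ℤ) * (-1) ^ j := by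
  rw [auxA_sum, ← auxA_eq]
  congr 1
  omega
end

section
/- For every integer n ≥ 1 and every integer d, the following identity holds in ℤ: (n+1)·(d-1)^n − Σ_{k=0}^{n} (d-1)^k = (d-2)·Σ_{k=0}^{n-1} α_k·d^k, where α_k = (k+1)·Σ_{j=0}^{n-1-k} C(n+1,j)·(-1)^j·2^{n-1-k-j} and C(a,b) denotes the binomial coefficient. -/
open Finset

def bco (N m : ℕ) : ℤ := ∑ j ∈ Finset.range (m + 1), (N.choose j : ℤ) * (-1) ^ j * 2 ^ (m - j)

lemma bco_aux (N : ℕ) (m : ℕ) (x : Polynomial ℤ) :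
    (x - 2) * ∑ k ∈ Finset.range (m + 1), (bco N (m - k) : Polynomial ℤ) * x ^ k
      = ∑ j ∈ Finset.range (m + 1),
        (N.choose j : Polynomial ℤ) * (-1) ^ j * (x ^ (m + 1 - j) - 2 ^ (m + 1 - j)) := by
  induction m with
  | zero => simp [bco]
  | succ m ih =>
    have h1 : ∑ k ∈ Finset.range (m + 1 + 1), (bco N (m + 1 - k) : Polynomial ℤ) * x ^ k
        = x * (∑ k ∈ Finset.range (m + 1), (bco N (m - k) : Polynomial ℤ) * x ^ k)
          + (bco N (m + 1) : Polynomial ℤ) := by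
      rw [Finset.sum_range_succ', Finset.mul_sum]
      congr 1
      · refine Finset.sum_congr rfl fun k _ => ?_
        rw [Nat.add_sub_add_right]; ring
      · simp
    have h2 : (bco N (m + 1) : Polynomial ℤ) = ∑ j ∈ Finset.range (m + 1 + 1),
        (N.choose j : Polynomial ℤ) * (-1) ^ j * 2 ^ (m + 1 - j) := by
      simp [bco]
    rw [h1, mul_add, mul_left_comm, ih, h2, Finset.sum_range_succ _ (m + 1),
      Finset.sum_range_succ _ (m + 1), mul_add, Finset.mul_sum, Finset.mul_sum, ← add_assoc,
      ← Finset.sum_add_distrib]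
    congr 1
    · refine Finset.sum_congr rfl fun j hj => ?_
      have hj' : j ≤ m := by simpa [Nat.lt_succ_iff] using hj
      rw [show m + 1 + 1 - j = (m + 1 - j) + 1 by omega]
      ring
    · rw [show m + 1 + 1 - (m + 1) = 1 by omega]
      simp; ring

lemma bco_pow (n : ℕ) (x : Polynomial ℤ) :
    ∑ j ∈ Finset.range (n + 1), ((n + 1).choose j : Polynomial ℤ) * (-1) ^ j * x ^ (n + 1 - j)
      = (x - 1) ^ (n + 1) - (-1) ^ (n + 1) := by
  have h := add_pow (-1 : Polynomial ℤ) x (n + 1)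
  rw [Finset.sum_range_succ] at h
  rw [show x - 1 = -1 + x by ring, h]
  simp only [Nat.choose_self, Nat.sub_self, pow_zero, mul_one, Nat.cast_one, add_sub_cancel_right]
  exact Finset.sum_congr rfl fun j _ => by ring

open Polynomial in
lemma bco_main (n : ℕ) :
    (∑ k ∈ Finset.range (n + 1), (bco (n + 1) (n - k) : ℤ[X]) * X ^ k)
      = ∑ k ∈ Finset.range (n + 1), (X - 1 : ℤ[X]) ^ k := by
  have h0 : (X - 2 : ℤ[X]) ≠ 0 := X_sub_C_ne_zero (2 : ℤ)
  apply mul_left_cancel₀ h0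
  rw [bco_aux]
  simp only [mul_sub, Finset.sum_sub_distrib]
  rw [bco_pow, bco_pow, show (2 - 1 : ℤ[X]) = 1 by norm_num]
  have := mul_geom_sum (X - 1 : ℤ[X]) (n + 1)
  rw [show (X - 2 : ℤ[X]) = X - 1 - 1 by ring, this, one_pow]
  ring

/-- For `n ≥ 1` and any integer `d`:
`(n+1)·(d-1)^n − ∑_{k=0}^{n} (d-1)^k = (d-2)·∑_{k=0}^{n-1} α_k·d^k`, where
`α_k = (k+1)·∑_{j=0}^{n-1-k} C(n+1,j)·(-1)^j·2^(n-1-k-j)`. -/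
theorem phi_eq_alpha_expansion
    (n : ℕ) (hn : 1 ≤ n) (d : ℤ) :
    ((n : ℤ) + 1) * (d - 1) ^ n - (∑ k ∈ Finset.range (n + 1), (d - 1) ^ k)
      = (d - 2) * ∑ k ∈ Finset.range n,
          (((k : ℤ) + 1) * ∑ j ∈ Finset.range (n - 1 - k + 1),
            ((n + 1).choose j : ℤ) * (-1) ^ j * 2 ^ (n - 1 - k - j)) * d ^ k := by
  have hm := bco_main n
  have hg := mul_geom_sum (Polynomial.X - 1 : Polynomial ℤ) (n + 1)
  rw [← hm] at hg
  have hd := congrArg (fun p => Polynomial.eval d (Polynomial.derivative p)) hg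
  have he := congrArg (Polynomial.eval d) hm
  simp only [Polynomial.derivative_mul, Polynomial.derivative_sub, Polynomial.derivative_sum,
    Polynomial.derivative_X_pow, Polynomial.derivative_pow, Polynomial.derivative_X,
    Polynomial.derivative_one, Polynomial.derivative_intCast, Polynomial.eval_add,
    Polynomial.eval_mul, Polynomial.eval_sub, Polynomial.eval_finset_sum, Polynomial.eval_pow,
    Polynomial.eval_X, Polynomial.eval_one, Polynomial.eval_intCast, Polynomial.eval_C,
    Polynomial.eval_zero, Polynomial.eval_natCast] at hd he
  rw [he] at hd
  rw [Finset.sum_range_succ' (fun k => _ + _)] at hd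
  have hs : ∑ k ∈ Finset.range n,
          (((k : ℤ) + 1) * ∑ j ∈ Finset.range (n - 1 - k + 1),
            ((n + 1).choose j : ℤ) * (-1) ^ j * 2 ^ (n - 1 - k - j)) * d ^ k
      = ∑ k ∈ Finset.range n, ((k : ℤ) + 1) * bco (n + 1) (n - (k + 1)) * d ^ k := by
    refine Finset.sum_congr rfl fun k _ => ?_
    rw [bco, show n - (k + 1) = n - 1 - k by omega]
  rw [hs]
  have ht : ∑ k ∈ Finset.range n, ((k : ℤ) + 1) * bco (n + 1) (n - (k + 1)) * d ^ k
     = ∑ k ∈ Finset.range n, bco (n + 1) (n - (k + 1)) * (((k : ℤ) + 1) * d ^ k) :=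
    Finset.sum_congr rfl fun k _ => by ring
  rw [ht]
  simp at hd
  linear_combination -hd
end

section
/- Let f be a homogeneous polynomial of degree d ≥ 1 in the two variables x_1, x_2 over ℂ. Then f admits an isotropic eigenvector, i.e. there exist x = (x_1,x_2) ≠ (0,0) with x_1² + x_2² = 0 and λ ∈ ℂ such that ∂f/∂x_i(x) = d·λ·x_i for i = 1,2, if and only if f(1, i)·f(1, −i) = 0, where i = √−1. -/
open MvPolynomial

theorem aux_euler (d : ℕ) (f : MvPolynomial (Fin 2) ℂ) (hf : f.IsHomogeneous d) (x : Fin 2 → ℂ) :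
    x 0 * eval x (pderiv 0 f) + x 1 * eval x (pderiv 1 f) = d * eval x f := by
  have h := congrArg (eval x) hf.sum_X_mul_pderiv
  simpa [Fin.sum_univ_two] using h

theorem aux_smul (d : ℕ) (f : MvPolynomial (Fin 2) ℂ) (hf : f.IsHomogeneous d) (c : ℂ)
    (x : Fin 2 → ℂ) : eval (c • x) f = c ^ d * eval x f := by
  rw [eval_eq, eval_eq, Finset.mul_sum]
  refine Finset.sum_congr rfl fun m hm => ?_
  have h := hf.degree_eq_sum_deg_support hm
  simp only [Pi.smul_apply, smul_eq_mul, mul_pow, Finset.prod_mul_distrib, Finset.prod_pow_eq_pow_sum]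
  rw [← h]
  ring

theorem aux_back (d : ℕ) (hd : 1 ≤ d) (f : MvPolynomial (Fin 2) ℂ) (hf : f.IsHomogeneous d)
    (j : ℂ) (hj : j ^ 2 = -1) (h0 : eval ![1, j] f = 0) :
    ∃ x : Fin 2 → ℂ, x ≠ 0 ∧ (x 0) ^ 2 + (x 1) ^ 2 = 0 ∧
        ∃ lam : ℂ, ∀ i, eval x (pderiv i f) = (d : ℂ) * lam * x i := by
  have hd' : (d : ℂ) ≠ 0 := by exact_mod_cast (by omega : d ≠ 0)
  have h := aux_euler d f hf ![1, j]
  rw [h0] at h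
  refine ⟨![1, j], fun h => by simpa using congrFun h 0, by simp [hj],
    eval ![1, j] (pderiv 0 f) / d, ?_⟩
  rw [mul_div_cancel₀ _ hd', Fin.forall_fin_two]
  simp only [Matrix.cons_val_zero, Matrix.cons_val_one] at h ⊢
  refine ⟨by ring, ?_⟩
  linear_combination (-j) * h + (eval ![1, j] (pderiv 1 f)) * hj

/-- A binary form `f` of degree `d ≥ 1` admits an isotropic eigenvector if and only if
`f(1, i)·f(1, −i) = 0`. -/
theorem binary_isotropic_eigenvector_iff
    (d : ℕ) (hd : 1 ≤ d)
    (f : MvPolynomial (Fin 2) ℂ) (hf : f.IsHomogeneous d) :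
    (∃ x : Fin 2 → ℂ, x ≠ 0 ∧ (x 0) ^ 2 + (x 1) ^ 2 = 0 ∧
        ∃ lam : ℂ, ∀ i, eval x (pderiv i f) = (d : ℂ) * lam * x i)
    ↔ eval ![1, Complex.I] f * eval ![1, -Complex.I] f = 0 := by
  constructor
  · rintro ⟨x, hx, hq, lam, hl⟩
    have hd' : (d : ℂ) ≠ 0 := by exact_mod_cast (by omega : d ≠ 0)
    have hfx : eval x f = 0 := by
      have h := aux_euler d f hf x
      rw [hl 0, hl 1] at h
      have : (d : ℂ) * eval x f = 0 := by linear_combination -h + d * lam * hq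
      exact (mul_eq_zero.mp this).resolve_left hd'
    have hx0 : x 0 ≠ 0 := by
      intro h0
      apply hx
      have h1 : x 1 = 0 := by simpa [h0] using hq
      ext i
      fin_cases i <;> simp [h0, h1]
    have key : ∀ j : ℂ, x 1 = x 0 * j → eval ![1, j] f = 0 := by
      intro j hj
      have hxe : x = x 0 • ![1, j] := by
        ext i
        fin_cases i <;> simp [hj]
      have h := aux_smul d f hf (x 0) ![1, j]
      rw [← hxe, hfx] at h
      exact (mul_eq_zero.mp h.symm).resolve_left (pow_ne_zero _ hx0)
    have hfac : (x 1 - x 0 * Complex.I) * (x 1 - x 0 * -Complex.I) = 0 := by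
      linear_combination hq - (x 0) ^ 2 * Complex.I_sq
    rcases mul_eq_zero.mp hfac with h | h
    · rw [key _ (sub_eq_zero.mp h), zero_mul]
    · rw [key _ (sub_eq_zero.mp h), mul_zero]
  · intro h
    rcases mul_eq_zero.mp h with h | h
    · exact aux_back d hd f hf _ Complex.I_sq h
    · exact aux_back d hd f hf _ (by rw [neg_sq, Complex.I_sq]) h
end

section
/- (Cartwright–Sturmfels bound, even case) Let d ≥ 3 be even and let f be a homogeneous polynomial of degree d in the variables x_1,…,x_{n+1} over ℂ. Then the set of E-eigenvalues of f, namely {λ ∈ ℂ : there exists x ∈ ℂ^{n+1} with Σ_i x_i² = 1 and ∂f/∂x_i(x) = d·λ·x_i for all i}, is finite and has at most ((d-1)^{n+1} − 1)/(d-2) elements. -/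
open MvPolynomial


theorem cs_trdeg_quot {k T : Type} [Field k] [CommRing T] [IsDomain T] [Algebra k T]
    [Algebra.FiniteType k T] (u : T) (P : Ideal T) (hP : P ∈ (Ideal.span {u}).minimalPrimes) :
    Algebra.trdeg k T ≤ Algebra.trdeg k (T ⧸ P) + 1 := by
  classical
  have hPp : P.IsPrime := hP.1.1
  have huP : u ∈ P := hP.1.2 (Ideal.mem_span_singleton_self u)
  have hNoeth : IsNoetherianRing T := Algebra.FiniteType.isNoetherianRing k T
  obtain ⟨z, hz⟩ := exists_isTranscendenceBasis k (T ⧸ P)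
  let lift : (T ⧸ P) → T := Function.surjInv Ideal.Quotient.mk_surjective
  have hlift : ∀ a, Ideal.Quotient.mk P (lift a) = a :=
    Function.surjInv_eq Ideal.Quotient.mk_surjective
  let s : Set T := insert u (lift '' z)
  let R := Algebra.adjoin k s
  have hRft : Algebra.FiniteType R T := Algebra.FiniteType.of_restrictScalars_finiteType k R T
  -- incomparability
  have hinc : ∀ q : Ideal T, q.IsPrime → P ≤ q →
      q.comap (algebraMap R T) = P.comap (algebraMap R T) → q ≤ P := by
    intro q hq hPq hqR a ha
    by_contra haP
    have halg := hz.isAlgebraic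
    have hane : Ideal.Quotient.mk P a ≠ 0 := fun h => haP (Ideal.Quotient.eq_zero_iff_mem.mp h)
    obtain ⟨r, hr0, c, hc⟩ := (halg.isAlgebraic (Ideal.Quotient.mk P a)).exists_nonzero_dvd
      (mem_nonZeroDivisors_of_ne_zero hane)
    have hmap : Algebra.adjoin k (Set.range ((↑) : z → T ⧸ P)) ≤
        R.map (Ideal.Quotient.mkₐ k P) := by
      rw [Subtype.range_coe, AlgHom.map_adjoin]
      refine Algebra.adjoin_mono ?_
      intro y hy
      exact ⟨lift y, Set.mem_insert_of_mem _ ⟨y, hy, rfl⟩, hlift y⟩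
    obtain ⟨r', hr', hr'r⟩ := hmap r.2
    obtain ⟨c', rfl⟩ := Ideal.Quotient.mk_surjective c
    have hr'r2 : Ideal.Quotient.mk P r' = r.1 := hr'r
    have h1 : r' - a * c' ∈ P := by
      rw [← Ideal.Quotient.eq, hr'r2, map_mul]
      exact hc
    have h2 : r' ∈ q := by
      have := q.add_mem (hPq h1) (q.mul_mem_right c' ha)
      simpa using this
    have h3 : (⟨r', hr'⟩ : R) ∈ q.comap (algebraMap R T) := h2
    rw [hqR] at h3
    have h4 : r' ∈ P := h3
    apply hr0
    apply Subtype.ext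
    rw [← hr'r2]
    exact Ideal.Quotient.eq_zero_iff_mem.mpr h4
  -- the separating element
  obtain ⟨g, hgP, hg⟩ : ∃ g ∉ P, ∀ q : Ideal T, q.IsPrime → u ∈ q → g ∉ q → P ≤ q := by
    have hfin : (Ideal.span {u}).minimalPrimes.Finite :=
      Ideal.finite_minimalPrimes_of_isNoetherianRing T _
    have : ¬ (∏ Q ∈ hfin.toFinset.erase P, Q ≤ P) := by
      rw [Ideal.IsPrime.prod_le hPp]
      rintro ⟨Q, hQ, hQP⟩
      rw [Finset.mem_erase, Set.Finite.mem_toFinset] at hQ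
      exact hQ.1 (le_antisymm hQP (hP.2 hQ.2.1 hQP))
    obtain ⟨g, hg, hgP⟩ := SetLike.not_le_iff_exists.mp this
    refine ⟨g, hgP, fun q hq huq hgq => ?_⟩
    obtain ⟨Q, hQ, hQq⟩ := Ideal.exists_minimalPrimes_le
      (I := Ideal.span {u}) (J := q) (by simpa [Ideal.span_le] using huq)
    by_cases h : Q = P
    · exact h ▸ hQq
    · exfalso
      apply hgq
      apply hQq
      have : (∏ Q ∈ hfin.toFinset.erase P, Q) ≤ Q :=
        le_trans Ideal.prod_le_inf (Finset.inf_le (by simp [h, hQ]))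
      exact this hg
  have hqf : Algebra.QuasiFiniteAt R P := by
    refine Algebra.QuasiFiniteAt.of_isOpen_singleton_fiber (R := R) (⟨P, hPp⟩ : PrimeSpectrum T) ?_
    rw [isOpen_induced_iff]
    refine ⟨PrimeSpectrum.basicOpen g, (PrimeSpectrum.basicOpen g).isOpen, ?_⟩
    ext ⟨q, hq⟩
    simp only [Set.mem_preimage, SetLike.mem_coe, PrimeSpectrum.mem_basicOpen, Set.mem_singleton_iff]
    constructor
    · intro hgq
      have hq' : q.asIdeal.comap (algebraMap R T) = P.comap (algebraMap R T) := by
        have := congrArg PrimeSpectrum.asIdeal hq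
        simpa using this
      have huq : u ∈ q.asIdeal := by
        have h1 : (⟨u, Algebra.subset_adjoin (Set.mem_insert _ _)⟩ : R) ∈ P.comap (algebraMap R T) := huP
        rw [← hq'] at h1
        exact h1
      have h2 := hg q.asIdeal q.2 huq hgq
      have h3 := hinc q.asIdeal q.2 h2 hq'
      apply Subtype.ext
      exact PrimeSpectrum.ext (le_antisymm h3 h2)
    · intro h
      have : q = ⟨P, hPp⟩ := congrArg Subtype.val h
      rw [this]; exact hgP
  obtain ⟨r, hrP, hr, hx⟩ := Algebra.zariskisMainProperty_iff.mp
    (Algebra.ZariskisMainProperty.of_finiteType (R := R) P)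
  have halg : Algebra.IsAlgebraic R T := by
    constructor
    intro x
    obtain ⟨m, hm⟩ := hx x
    have hr0 : r ≠ 0 := fun h => hrP (h ▸ P.zero_mem)
    exact IsAlgebraic.of_mul (mem_nonZeroDivisors_of_ne_zero (pow_ne_zero m hr0))
      ((hr.pow m).isAlgebraic) hm.isAlgebraic
  calc Algebra.trdeg k T ≤ Cardinal.mk s := Algebra.IsAlgebraic.trdeg_le_cardinalMk k s
    _ ≤ Cardinal.mk (lift '' z) + 1 := Cardinal.mk_insert_le
    _ ≤ Cardinal.mk z + 1 := by gcongr; exact Cardinal.mk_image_le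
    _ = _ := by rw [hz.cardinalMk_eq_trdeg]


theorem cs_algebraic_of_D {L : Type} [Field L] [Algebra ℂ L] [Algebra.EssFiniteType ℂ L] (θ : L)
    (h : KaehlerDifferential.D ℂ L θ = 0) : IsAlgebraic ℂ θ := by
  by_contra htr
  have hinj : Function.Injective (Polynomial.aeval (R := ℂ) θ) :=
    transcendental_iff_injective.mp htr
  letI : Algebra (Polynomial ℂ) L := (Polynomial.aeval (R := ℂ) θ).toRingHom.toAlgebra
  have hst : IsScalarTower ℂ (Polynomial ℂ) L := IsScalarTower.of_algebraMap_eq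
    (fun x => by
      change _ = Polynomial.aeval θ (algebraMap ℂ (Polynomial ℂ) x)
      simp)
  have hfs : FaithfulSMul (Polynomial ℂ) L := (faithfulSMul_iff_algebraMap_injective _ _).mpr hinj
  let K := FractionRing (Polynomial ℂ)
  letI : Algebra K L := FractionRing.liftAlgebra (Polynomial ℂ) L
  have hst2 : IsScalarTower (Polynomial ℂ) K L := FractionRing.isScalarTower_liftAlgebra _ _
  have hst3 : IsScalarTower ℂ K L := IsScalarTower.to₁₃₄ ℂ (Polynomial ℂ) K L
  have hc : CharZero K := algebraRat.charZero K
  have hes : Algebra.EssFiniteType K L := Algebra.EssFiniteType.of_comp ℂ K L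
  have hsm : Algebra.FormallySmooth K L := Algebra.FormallySmooth.of_perfectField
  have hsm1 : Algebra.FormallySmooth (Polynomial ℂ) K :=
    Algebra.FormallySmooth.of_isLocalization (nonZeroDivisors (Polynomial ℂ))
  have hsm2 : Algebra.FormallySmooth (Polynomial ℂ) L := Algebra.FormallySmooth.comp _ K L
  have hinj2 : Function.Injective (KaehlerDifferential.mapBaseChange ℂ (Polynomial ℂ) L) := by
    rw [injective_iff_map_eq_zero]
    intro x hx
    obtain ⟨x, rfl⟩ := (Algebra.H1Cotangent.exact_δ_mapBaseChange ℂ (Polynomial ℂ) L x).mp hx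
    rw [Subsingleton.elim x 0, map_zero]
  have h0 : (TensorProduct.tmul (Polynomial ℂ) (1 : L)
      (KaehlerDifferential.D ℂ (Polynomial ℂ) Polynomial.X)) = 0 := by
    apply hinj2
    rw [KaehlerDifferential.mapBaseChange_tmul, one_smul, KaehlerDifferential.map_D, map_zero]
    have : algebraMap (Polynomial ℂ) L Polynomial.X = θ := Polynomial.aeval_X θ
    rw [this, h]
  have h1 := congrArg (TensorProduct.rid (Polynomial ℂ) L ∘
    (LinearMap.lTensor L (KaehlerDifferential.polynomialEquiv ℂ).toLinearMap)) h0
  simp at h1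

theorem cs_D_aeval {L : Type} [Field L] [Algebra ℂ L] {m : ℕ} (x : Fin m → L)
    (p : MvPolynomial (Fin m) ℂ) :
    KaehlerDifferential.D ℂ L (aeval x p) =
      ∑ i, aeval x (pderiv i p) • KaehlerDifferential.D ℂ L (x i) := by
  induction p using MvPolynomial.induction_on with
  | C a => simp [← algebraMap_eq]
  | add p q hp hq => simp [hp, hq, add_smul, Finset.sum_add_distrib]
  | mul_X p j hp =>
    rw [map_mul, Derivation.leibniz, hp, aeval_X]
    simp only [Derivation.leibniz, map_add, smul_eq_mul, add_smul, Finset.sum_add_distrib, map_mul,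
      aeval_X, pderiv_X, Finset.smul_sum, mul_smul]
    congr 1
    rw [Finset.sum_eq_single j]
    · simp
    · intro b _ hb; simp [Pi.single_apply, hb.symm]
    · simp

theorem cs_const {L : Type} [Field L] [Algebra ℂ L] [Algebra.EssFiniteType ℂ L] {m : ℕ} (s : ℕ)
    (f : MvPolynomial (Fin m) ℂ) (hf : f.IsHomogeneous (2 * s + 2)) (x : Fin m → L) (l : L)
    (hx : ∀ i, aeval x (pderiv i f) = algebraMap ℂ L (2 * s + 2 : ℂ) * (l * x i))
    (hQ : ∑ i, x i ^ 2 ≠ 0) :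
    ∃ c : ℂ, l = algebraMap ℂ L c * (∑ i, x i ^ 2) ^ s := by
  set Q := ∑ i, x i ^ 2 with hQdef
  have hcz : CharZero L := charZero_of_injective_algebraMap (algebraMap ℂ L).injective
  have hd0 : (2 * s + 2 : L) ≠ 0 := by exact_mod_cast (by omega : 2 * s + 2 ≠ 0)
  have heul : aeval x f = l * Q := by
    have h1 := hf.sum_X_mul_pderiv
    have h2 := congrArg (aeval x) h1
    simp only [map_sum, map_mul, aeval_X, hx, map_nsmul, nsmul_eq_mul] at h2
    have h2' : aeval x ((2 * s + 2 : ℕ) : MvPolynomial (Fin m) ℂ) = (2 * s + 2 : L) := by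
      rw [map_natCast]; push_cast; ring
    rw [h2'] at h2
    apply mul_left_cancel₀ hd0
    rw [← h2, hQdef, Finset.mul_sum, Finset.mul_sum]
    refine Finset.sum_congr rfl fun i _ => ?_
    simp only [map_add, map_mul, map_natCast, map_ofNat]
    ring
  let D := KaehlerDifferential.D ℂ L
  have hDQ : D Q = (2 : L) • ∑ i, x i • D (x i) := by
    rw [hQdef, map_sum, Finset.smul_sum]
    refine Finset.sum_congr rfl fun i _ => ?_
    rw [Derivation.leibniz_pow]
    simp [← Nat.cast_smul_eq_nsmul L]
  have hDf : D (aeval x f) = ((2 * s + 2 : L) * l) • ∑ i, x i • D (x i) := by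
    change KaehlerDifferential.D ℂ L (aeval x f) = _
    rw [cs_D_aeval, Finset.smul_sum]
    refine Finset.sum_congr rfl fun i _ => ?_
    rw [hx, smul_smul]
    simp only [map_add, map_mul, map_natCast, map_ofNat]
    congr 1; ring
  have hDf2 : D (aeval x f) = l • D Q + Q • D l := by rw [heul, Derivation.leibniz]
  have key : Q • D l = ((s : L) * l) • D Q := by
    have : l • D Q + Q • D l = ((s + 1 : L) * l) • D Q := by
      rw [← hDf2, hDf, hDQ, smul_smul]; congr 1; ring
    have h3 : Q • D l = ((s + 1 : L) * l) • D Q - l • D Q := by rw [← this]; abel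
    rw [h3, ← sub_smul]; congr 1; ring
  have hθ : D (l / Q ^ s) = 0 := by
    have h1 : l = (l / Q ^ s) * Q ^ s := by field_simp
    set θ := l / Q ^ s with hθd
    have h2 : Q • D l = Q • ((θ * (s * Q ^ (s - 1))) • D Q + Q ^ s • D θ) := by
      congr 1
      conv_lhs => rw [h1]
      rw [Derivation.leibniz, Derivation.leibniz_pow, ← Nat.cast_smul_eq_nsmul L]
      simp only [smul_smul, smul_eq_mul, mul_assoc]
    rw [key, smul_add, smul_smul, smul_smul] at h2
    have h4 : Q * (θ * (s * Q ^ (s - 1))) = s * l := by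
      conv_rhs => rw [h1]
      rcases s with _ | s
      · simp
      · simp only [Nat.add_sub_cancel, pow_succ]; ring
    rw [h4, left_eq_add] at h2
    exact (smul_eq_zero.mp h2).resolve_left (mul_ne_zero hQ (pow_ne_zero _ hQ))
  have halg := cs_algebraic_of_D _ hθ
  have hint : IsIntegral ℂ (l / Q ^ s) := halg.isIntegral
  obtain ⟨c, hc⟩ := minpoly.mem_range_of_degree_eq_one ℂ (l / Q ^ s)
    (IsAlgClosed.degree_eq_one_of_irreducible ℂ (minpoly.irreducible hint))
  refine ⟨c, ?_⟩
  rw [hc]; field_simp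


abbrev CsS (m : ℕ) := MvPolynomial (Option (Fin m)) ℂ

noncomputable def csT {m : ℕ} (h : Fin m → CsS m) : Subalgebra ℂ (LaurentPolynomial (CsS m)) :=
  Algebra.adjoin ℂ (Set.range (fun v => LaurentPolynomial.C (X v)) ∪ {LaurentPolynomial.T 1} ∪
    Set.range (fun i => LaurentPolynomial.C (h i) * LaurentPolynomial.T (-1)))

instance csT_ft {m : ℕ} (h : Fin m → CsS m) : Algebra.FiniteType ℂ (csT h) := by
  rw [← Subalgebra.fg_iff_finiteType]
  unfold csT
  refine Subalgebra.fg_def.2 ⟨_, ?_, rfl⟩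
  exact ((Set.finite_range _).union (Set.finite_singleton _)).union (Set.finite_range _)

noncomputable def csCalg (m : ℕ) : CsS m →ₐ[ℂ] LaurentPolynomial (CsS m) :=
  (Algebra.ofId (CsS m) (LaurentPolynomial (CsS m))).restrictScalars ℂ

theorem csCalg_apply (m : ℕ) (g : CsS m) : csCalg m g = LaurentPolynomial.C g := rfl

theorem csC_mem {m : ℕ} (h : Fin m → CsS m) (g : CsS m) : csCalg m g ∈ csT h := by
  induction g using MvPolynomial.induction_on with
  | C a =>
    rw [← MvPolynomial.algebraMap_eq, AlgHom.commutes]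
    exact Subalgebra.algebraMap_mem _ _
  | add p q hp hq => rw [map_add]; exact add_mem hp hq
  | mul_X p j hp =>
    rw [map_mul]
    exact mul_mem hp (Algebra.subset_adjoin (Or.inl (Or.inl ⟨j, rfl⟩)))

noncomputable def csI {m : ℕ} (h : Fin m → CsS m) : CsS m →ₐ[ℂ] csT h :=
  (csCalg m).codRestrict (csT h) (csC_mem h)

noncomputable def csU {m : ℕ} (h : Fin m → CsS m) : csT h :=
  ⟨LaurentPolynomial.T 1, Algebra.subset_adjoin (Or.inl (Or.inr rfl))⟩

noncomputable def csH {m : ℕ} (h : Fin m → CsS m) (i : Fin m) : csT h :=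
  ⟨LaurentPolynomial.C (h i) * LaurentPolynomial.T (-1), Algebra.subset_adjoin (Or.inr ⟨i, rfl⟩)⟩

theorem csU_mul_csH {m : ℕ} (h : Fin m → CsS m) (i : Fin m) :
    csU h * csH h i = csI h (h i) := by
  apply Subtype.ext
  change LaurentPolynomial.T 1 * (LaurentPolynomial.C (h i) * LaurentPolynomial.T (-1)) =
    LaurentPolynomial.C (h i)
  rw [mul_left_comm, ← LaurentPolynomial.T_add]
  simp

theorem csT_gen {m : ℕ} (h : Fin m → CsS m) (A : Subalgebra ℂ (csT h))
    (h1 : ∀ v, csI h (X v) ∈ A) (h2 : csU h ∈ A) (h3 : ∀ i, csH h i ∈ A) : A = ⊤ := by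
  have key : csT h ≤ A.map (csT h).val := by
    apply Algebra.adjoin_le
    rintro y ((⟨v, rfl⟩ | hy) | ⟨i, rfl⟩)
    · exact ⟨_, h1 v, rfl⟩
    · rw [Set.mem_singleton_iff] at hy
      subst hy; exact ⟨_, h2, rfl⟩
    · exact ⟨_, h3 i, rfl⟩
  rw [eq_top_iff]
  rintro ⟨y, hy⟩ _
  obtain ⟨z, hz, hzy⟩ := key hy
  have : z = ⟨y, hy⟩ := Subtype.ext hzy
  rwa [← this]

theorem csT_trdeg {m : ℕ} (h : Fin m → CsS m) : ((m + 2 : ℕ) : Cardinal) ≤ Algebra.trdeg ℂ (csT h) := by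
  let g : Polynomial (CsS m) →ₐ[ℂ] LaurentPolynomial (CsS m) :=
    (Polynomial.toLaurentAlg (R := CsS m)).restrictScalars ℂ
  have hg : ∀ p, g p ∈ csT h := by
    intro p
    induction p using Polynomial.induction_on' with
    | add p q hp hq => rw [map_add]; exact add_mem hp hq
    | monomial n a =>
      have : g (Polynomial.monomial n a) = csCalg m a * LaurentPolynomial.T 1 ^ n := by
        change Polynomial.toLaurent _ = _
        rw [← Polynomial.C_mul_X_pow_eq_monomial, map_mul, map_pow, Polynomial.toLaurent_X,
          Polynomial.toLaurent_C]
        rfl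
      rw [this]
      exact mul_mem (csC_mem h a) (pow_mem (csU h).2 n)
  have hinj : Function.Injective (g.codRestrict (csT h) hg) := by
    intro a b hab
    apply Polynomial.toLaurent_injective
    exact congrArg Subtype.val hab
  refine le_trans ?_ (trdeg_le_of_injective _ hinj)
  rw [← trdeg_add_eq ℂ (CsS m) (A := Polynomial (CsS m)), MvPolynomial.trdeg_of_isDomain,
    Polynomial.trdeg_of_isDomain]
  simp
  apply le_of_eq; ring

theorem csT_point {m : ℕ} (h : Fin m → CsS m) (p : Option (Fin m) → ℂ) (hp : ∀ i, eval p (h i) = 0) :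
    ∃ χ : csT h →ₐ[ℂ] ℂ, χ (csU h) = 0 ∧ ∀ g, χ (csI h g) = eval p g := by
  let Ψ : LaurentPolynomial (CsS m) →ₐ[ℂ] LaurentPolynomial ℂ :=
    AddMonoidAlgebra.mapAlgHom ℤ (aeval p : CsS m →ₐ[ℂ] ℂ)
  have hΨ : ∀ (g : CsS m) (n : ℤ), Ψ (LaurentPolynomial.C g * LaurentPolynomial.T n) =
      LaurentPolynomial.C (eval p g) * LaurentPolynomial.T n := by
    intro g n
    rw [← LaurentPolynomial.single_eq_C_mul_T, ← LaurentPolynomial.single_eq_C_mul_T]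
    exact AddMonoidAlgebra.map_single _ _ _
  have hΨC : ∀ (g : CsS m), Ψ (LaurentPolynomial.C g) = LaurentPolynomial.C (eval p g) := by
    intro g; simpa using hΨ g 0
  have hΨT : Ψ (LaurentPolynomial.T 1) = LaurentPolynomial.T 1 := by
    simpa using hΨ 1 1
  let R := (Polynomial.toLaurentAlg (R := ℂ)).range
  have hR : ∀ y : csT h, (Ψ.comp (csT h).val) y ∈ R := by
    have : R.comap (Ψ.comp (csT h).val) = ⊤ := by
      apply csT_gen
      · intro v
        refine ⟨Polynomial.C (eval p (X v)), ?_⟩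
        change Polynomial.toLaurent _ = Ψ (LaurentPolynomial.C (X v))
        rw [hΨC, Polynomial.toLaurent_C]
      · refine ⟨Polynomial.X, ?_⟩
        change Polynomial.toLaurent _ = Ψ (LaurentPolynomial.T 1)
        rw [hΨT, Polynomial.toLaurent_X]
      · intro i
        refine ⟨0, ?_⟩
        change _ = Ψ (LaurentPolynomial.C (h i) * _)
        rw [hΨ, hp]; simp
    intro y
    have hy : y ∈ R.comap (Ψ.comp (csT h).val) := by rw [this]; trivial
    exact hy
  let e := AlgEquiv.ofInjective (Polynomial.toLaurentAlg (R := ℂ)) Polynomial.toLaurent_injective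
  let χ : csT h →ₐ[ℂ] ℂ := (Polynomial.aeval (0 : ℂ)).comp
    ((e.symm : R →ₐ[ℂ] Polynomial ℂ).comp ((Ψ.comp (csT h).val).codRestrict R hR))
  have hχ : ∀ (y : csT h) (q : Polynomial ℂ), Ψ y.1 = Polynomial.toLaurent q → χ y = q.eval 0 := by
    intro y q hq
    have : ((Ψ.comp (csT h).val).codRestrict R hR) y = e q := Subtype.ext hq
    simp only [χ, AlgHom.comp_apply, this]
    simp [Polynomial.coeff_zero_eq_eval_zero]
  refine ⟨χ, ?_, ?_⟩
  · rw [hχ _ Polynomial.X]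
    · simp
    · rw [Polynomial.toLaurent_X]; exact hΨT
  · intro g
    rw [hχ _ (Polynomial.C (eval p g))]
    · simp
    · rw [Polynomial.toLaurent_C]; exact hΨC g


def csWset {m : ℕ} (s a D : ℕ) : Set (Option (Fin m) →₀ ℕ) :=
  {b | b none ≤ a ∧ ∑ i, b (some i) + 2 * s * b none = D}

noncomputable def csW (m s a D : ℕ) : Submodule ℂ (CsS m) := restrictSupport ℂ (csWset s a D)

theorem csW_mem {m s a D : ℕ} {p : CsS m} : p ∈ csW m s a D ↔
    ∀ b ∈ p.support, b none ≤ a ∧ ∑ i, b (some i) + 2 * s * b none = D := Iff.rfl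

theorem csW_mono {m s a a' D : ℕ} (h : a ≤ a') {p : CsS m} (hp : p ∈ csW m s a D) :
    p ∈ csW m s a' D := fun b hb => ⟨(hp hb).1.trans h, (hp hb).2⟩

theorem csW_mul {m s a a' D D' : ℕ} {p q : CsS m} (hp : p ∈ csW m s a D)
    (hq : q ∈ csW m s a' D') : p * q ∈ csW m s (a + a') (D + D') := by
  classical
  rw [csW_mem] at *
  intro b hb
  obtain ⟨b1, h1, b2, h2, rfl⟩ := Finset.mem_add.1 (support_mul p q hb)
  have := hp b1 h1
  have := hq b2 h2
  simp only [Finsupp.add_apply, Finset.sum_add_distrib]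
  constructor
  · omega
  · rw [mul_add]; omega

theorem csW_C {m s : ℕ} (c : ℂ) : (C c : CsS m) ∈ csW m s 0 0 := by
  classical
  rw [csW_mem]
  intro b hb
  rw [mem_support_iff, coeff_C] at hb
  have : b = 0 := by by_contra h; exact hb (if_neg (Ne.symm h))
  subst this; simp

theorem csW_one {m s : ℕ} : (1 : CsS m) ∈ csW m s 0 0 := by
  simpa using csW_C (m := m) (s := s) 1

theorem csW_some {m s : ℕ} (i : Fin m) : (X (some i) : CsS m) ∈ csW m s 0 1 := by
  classical
  rw [csW_mem]
  intro b hb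
  rw [support_X, Finset.mem_singleton] at hb
  subst hb
  simp [Finsupp.single_apply]

theorem csW_none {m s : ℕ} : (X none : CsS m) ∈ csW m s 1 (2 * s) := by
  classical
  rw [csW_mem]
  intro b hb
  rw [support_X, Finset.mem_singleton] at hb
  subst hb
  simp [Finsupp.single_apply]

theorem csW_pow {m s a D : ℕ} {p : CsS m} (hp : p ∈ csW m s a D) (n : ℕ) :
    p ^ n ∈ csW m s (n * a) (n * D) := by
  induction n with
  | zero => simpa using csW_one
  | succ n ih => rw [pow_succ, Nat.succ_mul, Nat.succ_mul]; exact csW_mul ih hp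

theorem csW_prod {m s : ℕ} {ι : Type*} (t : Finset ι) (g : ι → CsS m) (a D : ι → ℕ)
    (h : ∀ i ∈ t, g i ∈ csW m s (a i) (D i)) :
    ∏ i ∈ t, g i ∈ csW m s (∑ i ∈ t, a i) (∑ i ∈ t, D i) := by
  classical
  induction t using Finset.induction_on with
  | empty => simpa using csW_one
  | insert i t hi ih =>
    rw [Finset.prod_insert hi, Finset.sum_insert hi, Finset.sum_insert hi]
    exact csW_mul (h i (by simp)) (ih fun j hj => h j (by simp [hj]))

theorem csW_rename {m s D : ℕ} {g : MvPolynomial (Fin m) ℂ} (hg : g.IsHomogeneous D) :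
    (rename some g : CsS m) ∈ csW m s 0 D := by
  classical
  rw [csW_mem]
  intro b hb
  rw [support_rename_of_injective (Option.some_injective _), Finset.mem_image] at hb
  obtain ⟨b', hb', rfl⟩ := hb
  have h0 : Finsupp.mapDomain some b' (none : Option (Fin m)) = 0 :=
    Finsupp.mapDomain_notin_range _ _ (by simp)
  have h1 : ∀ i, Finsupp.mapDomain some b' (some i : Option (Fin m)) = b' i := fun i =>
    Finsupp.mapDomain_apply (Option.some_injective _) _ _
  simp only [h0, h1]
  have := hg (mem_support_iff.1 hb')
  rw [Finsupp.weight_apply, Finsupp.sum_fintype _ _ (by simp)] at this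
  simpa using this

noncomputable def csQ (m : ℕ) : CsS m := ∑ i, X (some i) ^ 2

noncomputable def csHf {m : ℕ} (s : ℕ) (f : MvPolynomial (Fin m) ℂ) (i : Fin m) : CsS m :=
  C (1 / (2 * s + 2 : ℂ)) * rename some (pderiv i f) - X none * X (some i)

theorem csW_Q {m s : ℕ} : csQ m ∈ csW m s 0 2 :=
  Submodule.sum_mem _ fun i _ => by simpa using csW_pow (csW_some (s := s) i) 2

theorem csW_Hf {m s : ℕ} (f : MvPolynomial (Fin m) ℂ) (hf : f.IsHomogeneous (2 * s + 2))
    (i : Fin m) : csHf s f i ∈ csW m s 1 (2 * s + 1) := by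
  refine Submodule.sub_mem _ ?_ ?_
  · have h1 : (pderiv i f).IsHomogeneous (2 * s + 1) := hf.pderiv
    have := csW_mul (csW_C (s := s) (1 / (2 * s + 2 : ℂ))) (csW_rename (s := s) h1)
    rw [zero_add, zero_add] at this
    exact csW_mono zero_le_one this
  · exact csW_mul csW_none (csW_some i)


structure CsData {m : ℕ} (h : Fin m → CsS m) (T : Type) [CommRing T] [Algebra ℂ T] where
  I : CsS m →ₐ[ℂ] T
  U : T
  H : Fin m → T
  U_mul_H : ∀ i, U * H i = I (h i)
  gen : ∀ A : Subalgebra ℂ T, (∀ v, I (X v) ∈ A) → U ∈ A → (∀ i, H i ∈ A) → A = ⊤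
  trdeg : ((m + 2 : ℕ) : Cardinal) ≤ Algebra.trdeg ℂ T
  point : ∀ p : Option (Fin m) → ℂ, (∀ i, eval p (h i) = 0) →
    ∃ χ : T →ₐ[ℂ] ℂ, χ U = 0 ∧ ∀ g, χ (I g) = eval p g
  U_ne : U ≠ 0

noncomputable def csPt {m : ℕ} (x0 : Fin m → ℂ) (l0 : ℂ) : Option (Fin m) → ℂ :=
  fun o => o.elim l0 x0

theorem csPt_Q {m : ℕ} (x0 : Fin m → ℂ) (l0 : ℂ) (h : ∑ i, x0 i ^ 2 = 1) :
    eval (csPt x0 l0) (csQ m) = 1 := by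
  simpa [csQ, csPt, map_sum] using h

theorem cs_prime_const {m : ℕ} {s : ℕ} {f : MvPolynomial (Fin m) ℂ}
    {T : Type} [CommRing T] [IsDomain T] [Algebra ℂ T] [Algebra.FiniteType ℂ T] 
    (E : CsData (csHf s f) T)
    (hf : f.IsHomogeneous (2 * s + 2)) (x0 : Fin m → ℂ) (l0 : ℂ) (hx0 : ∑ i, x0 i ^ 2 = 1)
    (P : Ideal T) [P.IsPrime] (hu : E.U ∈ P)
    (hP : ∀ g, E.I g ∈ P → eval (csPt x0 l0) g = 0) :
    E.I (X none - C l0 * csQ m ^ s) ∈ P := by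
  let L := FractionRing (T ⧸ P)
  have hess : Algebra.EssFiniteType ℂ (T ⧸ P) := inferInstance
  have hessL : Algebra.EssFiniteType ℂ L := inferInstanceAs
    (Algebra.EssFiniteType ℂ (Localization (nonZeroDivisors (T ⧸ P))))
  let ρ : CsS m →ₐ[ℂ] L :=
    ((IsScalarTower.toAlgHom ℂ (T ⧸ P) L).comp (Ideal.Quotient.mkₐ ℂ P)).comp (E.I)
  have hρ : ∀ g, ρ g = 0 ↔ E.I g ∈ P := by
    intro g
    change algebraMap (T ⧸ P) L (Ideal.Quotient.mk P (E.I g)) = 0 ↔ _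
    rw [FaithfulSMul.algebraMap_eq_zero_iff, Ideal.Quotient.eq_zero_iff_mem]
  have hρH : ∀ i, ρ (csHf s f i) = 0 := by
    intro i
    rw [hρ, ← E.U_mul_H]
    exact P.mul_mem_right _ hu
  have hren : ∀ g : MvPolynomial (Fin m) ℂ,
      aeval (fun i => ρ (X (some i))) g = ρ (rename some g) := by
    intro g
    rw [← AlgHom.comp_apply]
    congr 1
    ext i; simp
  have hd0 : (2 * s + 2 : ℂ) ≠ 0 := by exact_mod_cast (by omega : 2 * s + 2 ≠ 0)
  have hQ : ∑ i, ρ (X (some i)) ^ 2 = ρ (csQ m) := by simp [csQ, map_sum]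
  obtain ⟨c, hc⟩ := cs_const (L := L) s f hf (fun i => ρ (X (some i))) (ρ (X none)) (by
    intro i
    rw [hren]
    have h1 := hρH i
    rw [csHf, map_sub, sub_eq_zero, map_mul, ← MvPolynomial.algebraMap_eq, AlgHom.commutes,
      map_mul] at h1
    rw [← h1, ← mul_assoc, ← map_mul, mul_one_div_cancel hd0, map_one, one_mul]) (by
    rw [hQ]
    intro h0
    have := hP _ ((hρ _).1 h0)
    rw [csPt_Q x0 l0 hx0] at this
    exact one_ne_zero this)
  rw [hQ] at hc
  have hz : ρ (X none - C c * csQ m ^ s) = 0 := by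
    rw [map_sub, map_mul, map_pow, ← MvPolynomial.algebraMap_eq, AlgHom.commutes, ← hc, sub_self]
  rw [hρ] at hz
  have h2 := hP _ hz
  rw [map_sub, map_mul, map_pow, csPt_Q x0 l0 hx0, eval_X, eval_C] at h2
  have h3 : c = l0 := by
    have : l0 - c * 1 ^ s = 0 := h2
    rw [one_pow, mul_one, sub_eq_zero] at this
    exact this.symm
  rwa [h3] at hz

theorem cs_prime_basis {m : ℕ} {s : ℕ} {f : MvPolynomial (Fin m) ℂ}
    {T : Type} [CommRing T] [IsDomain T] [Algebra ℂ T] [Algebra.FiniteType ℂ T] 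
    (E : CsData (csHf s f) T)
    (hf : f.IsHomogeneous (2 * s + 2)) (P : Ideal T) [P.IsPrime]
    (hu : E.U ∈ P) (i0 : Fin m) (hi0 : E.I (X (some i0)) ∉ P)
    (htr : ((m + 1 : ℕ) : Cardinal) ≤ Algebra.trdeg ℂ (T ⧸ P)) :
    ∃ (a : Fin (m + 1) → CsS m) (ε : Fin (m + 1) → ℕ) (w : Fin (m + 1) → T),
      (∀ i, a i ∈ csW m s 1 (2 * s + 1)) ∧
      (∀ i, E.U ^ ε i * w i = E.I (a i)) ∧
      AlgebraicIndependent ℂ (fun i => Ideal.Quotient.mk P (w i)) := by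
  let D := T ⧸ P
  let π : T →ₐ[ℂ] D := Ideal.Quotient.mkₐ ℂ P
  let G : Set D := {y | ∃ (a : CsS m) (ε : ℕ) (w : T), a ∈ csW m s 1 (2 * s + 1) ∧
    E.U ^ ε * w = E.I a ∧ π w = y}
  have hG0 : ∀ a ∈ csW m s 1 (2 * s + 1), π (E.I a) ∈ Algebra.adjoin ℂ G := fun a ha =>
    Algebra.subset_adjoin ⟨a, 0, E.I a, ha, by simp, rfl⟩
  have hG1 : ∀ i, π (E.H i) ∈ Algebra.adjoin ℂ G := fun i =>
    Algebra.subset_adjoin ⟨csHf s f i, 1, E.H i, csW_Hf f hf i, by rw [pow_one, E.U_mul_H], rfl⟩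
  have hdom : IsDomain D := Ideal.Quotient.isDomain P
  let A := Algebra.adjoin ℂ G
  have halgA : ∀ y ∈ A, IsAlgebraic A y := fun y hy => isAlgebraic_algebraMap (⟨y, hy⟩ : A)
  have hne : π (E.I (X (some i0))) ≠ 0 := by
    change Ideal.Quotient.mk P _ ≠ 0
    rwa [Ne, Ideal.Quotient.eq_zero_iff_mem]
  have hx0 : IsAlgebraic A (π (E.I (X (some i0)))) := by
    apply IsAlgebraic.of_pow (n := 2 * s + 1) (by omega)
    rw [← map_pow, ← map_pow]
    apply halgA
    apply hG0
    simpa using csW_mono zero_le_one (csW_pow (csW_some (s := s) i0) (2 * s + 1))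
  have hx : ∀ i, IsAlgebraic A (π (E.I (X (some i)))) := by
    intro i
    apply IsAlgebraic.of_mul (y := π (E.I (X (some i0))) ^ (2 * s))
      (mem_nonZeroDivisors_of_ne_zero (pow_ne_zero _ hne)) (hx0.pow _)
    rw [← map_pow, ← map_pow, ← map_mul, ← map_mul]
    apply halgA
    apply hG0
    simpa using csW_mono zero_le_one (csW_mul (csW_pow (csW_some (s := s) i0) (2 * s)) (csW_some i))
  have hl : IsAlgebraic A (π (E.I (X none))) := by
    apply IsAlgebraic.of_mul (y := π (E.I (X (some i0))))
      (mem_nonZeroDivisors_of_ne_zero hne) hx0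
    rw [← map_mul, ← map_mul]
    apply halgA
    apply hG0
    rw [mul_comm (X (some i0))]
    have hm := csW_mul (csW_none (m := m) (s := s)) (csW_some (s := s) i0)
    rwa [add_zero] at hm
  let B : Subalgebra ℂ D := (Subalgebra.algebraicClosure A D).restrictScalars ℂ
  have htop : B.comap π = ⊤ := by
    apply E.gen
    · rintro (_ | i)
      · exact hl
      · exact hx i
    · have : π (E.U) = 0 := Ideal.Quotient.eq_zero_iff_mem.2 hu
      change π (E.U) ∈ B
      rw [this]; exact zero_mem _
    · intro i
      exact halgA _ (hG1 i)
  have hAalg : Algebra.IsAlgebraic (Algebra.adjoin ℂ G) D := by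
    constructor
    intro y
    obtain ⟨z, rfl⟩ := Ideal.Quotient.mk_surjective y
    have : z ∈ B.comap π := by rw [htop]; trivial
    exact this
  have hnt : Nontrivial D := hdom.toNontrivial
  have hfs : FaithfulSMul ℂ D :=
    (faithfulSMul_iff_algebraMap_injective ℂ D).2 (algebraMap ℂ D).injective
  obtain ⟨t, htG, ht⟩ := exists_isTranscendenceBasis_subset (R := ℂ) G
  have hcard := ht.cardinalMk_eq_trdeg
  rw [← hcard] at htr
  have : Cardinal.mk (Fin (m + 1)) ≤ Cardinal.mk t := by simpa using htr
  obtain ⟨j⟩ := this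
  choose a ε w ha hw hy using fun i => htG (j i).2
  refine ⟨a, ε, w, ha, hw, ?_⟩
  have h1 := ht.1.comp j j.injective
  convert h1 using 2 with i
  exact hy i

theorem cs_prime {m : ℕ} {s : ℕ} {f : MvPolynomial (Fin m) ℂ}
    {T : Type} [CommRing T] [IsDomain T] [Algebra ℂ T] [Algebra.FiniteType ℂ T] 
    (E : CsData (csHf s f) T)
    (hf : f.IsHomogeneous (2 * s + 2)) (x0 : Fin m → ℂ) (l0 : ℂ) (hx0 : ∑ i, x0 i ^ 2 = 1)
    (hx : ∀ i, eval x0 (pderiv i f) = (2 * s + 2 : ℂ) * l0 * x0 i) :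
    ∃ P : Ideal T, P.IsPrime ∧ E.U ∈ P ∧
      (∀ g, E.I g ∈ P → eval (csPt x0 l0) g = 0) ∧
      E.I (X none - C l0 * csQ m ^ s) ∈ P ∧
      ∃ (a : Fin (m + 1) → CsS m) (ε : Fin (m + 1) → ℕ) (w : Fin (m + 1) → T),
      (∀ i, a i ∈ csW m s 1 (2 * s + 1)) ∧
      (∀ i, E.U ^ ε i * w i = E.I (a i)) ∧
      AlgebraicIndependent ℂ (fun i => Ideal.Quotient.mk P (w i)) := by
  have hd0 : (2 * s + 2 : ℂ) ≠ 0 := by exact_mod_cast (by omega : 2 * s + 2 ≠ 0)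
  have hren : ∀ g : MvPolynomial (Fin m) ℂ, eval (csPt x0 l0) (rename some g) = eval x0 g := by
    intro g
    rw [eval_rename]; rfl
  obtain ⟨χ, hχu, hχ⟩ := E.point (csPt x0 l0) (by
    intro i
    rw [csHf, map_sub, map_mul, map_mul, hren, hx, eval_C, eval_X, eval_X]
    change _ - l0 * x0 i = 0
    field_simp
    ring)
  have hle : Ideal.span {E.U} ≤ RingHom.ker χ := by
    rw [Ideal.span_singleton_le_iff_mem]
    exact hχu
  have hprime : (RingHom.ker χ).IsPrime := RingHom.ker_isPrime _
  obtain ⟨P, hPmin, hPle⟩ := Ideal.exists_minimalPrimes_le hle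
  have hPp : P.IsPrime := hPmin.1.1
  have hu : E.U ∈ P := hPmin.1.2 (Ideal.mem_span_singleton_self _)
  have hPe : ∀ g, E.I g ∈ P → eval (csPt x0 l0) g = 0 := by
    intro g hg
    rw [← hχ]
    exact hPle hg
  obtain ⟨i0, hi0⟩ : ∃ i, x0 i ≠ 0 := by
    by_contra! hc
    simp [hc] at hx0
  refine ⟨P, hPp, hu, hPe, cs_prime_const E hf x0 l0 hx0 P hu hPe,
    cs_prime_basis E hf P hu i0 ?_ ?_⟩
  · intro hm
    apply hi0
    simpa [csPt] using hPe _ hm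
  · have h1 := (E.trdeg).trans (cs_trdeg_quot (k := ℂ) (E.U) P hPmin)
    have h2 : ((m + 2 : ℕ) : Cardinal) = ((m + 1 : ℕ) : Cardinal) + 1 := by push_cast; ring
    rw [h2] at h1
    exact (Cardinal.add_one_le_add_one_iff).1 h1


noncomputable def csData {m : ℕ} (h : Fin m → CsS m) : CsData h (csT h) where
  I := csI h
  U := csU h
  H := csH h
  U_mul_H := csU_mul_csH h
  gen := csT_gen h
  trdeg := csT_trdeg h
  point := csT_point h
  U_ne := by
    intro h0
    exact (LaurentPolynomial.isUnit_T (R := CsS m) 1).ne_zero (congrArg Subtype.val h0)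

noncomputable def csPsi (m s : ℕ) (c : ℂ) : CsS m := (X none - C c * csQ m ^ s) * csQ m ^ (s + 1)

noncomputable def csPhi (m s : ℕ) {k : ℕ} (lam : Fin k → ℂ) (j : Fin k) : CsS m :=
  ∏ l ∈ Finset.univ.erase j, csPsi m s (lam l)

theorem csPsi_mem (m s : ℕ) (c : ℂ) : csPsi m s c ∈ csW m s 2 ((2 * s + 1) * 2) := by
  have h1 : (X none - C c * csQ m ^ s) ∈ csW m s 1 (2 * s) := by
    refine Submodule.sub_mem _ csW_none ?_
    have := csW_mul (csW_C (m := m) (s := s) c) (csW_pow (csW_Q (m := m) (s := s)) s)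
    have := csW_mono (a' := 1) (by omega) this
    rwa [zero_add, mul_comm s 2] at this
  have := csW_mul h1 (csW_pow (csW_Q (m := m) (s := s)) (s + 1))
  have := csW_mono (a' := 2) (by omega) this
  rwa [show 2 * s + (s + 1) * 2 = (2 * s + 1) * 2 by ring] at this

theorem csPhi_mem (m s : ℕ) {k : ℕ} (lam : Fin k → ℂ) (j : Fin k) :
    csPhi m s lam j ∈ csW m s (2 * (k - 1)) ((2 * s + 1) * (2 * (k - 1))) := by
  have := csW_prod (s := s) (Finset.univ.erase j) (fun l => csPsi m s (lam l)) (fun _ => 2)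
    (fun _ => (2 * s + 1) * 2) (fun l _ => csPsi_mem m s (lam l))
  simp only [Finset.sum_const, Finset.card_erase_of_mem (Finset.mem_univ j), Finset.card_univ,
    Fintype.card_fin, smul_eq_mul] at this
  rw [csPhi]
  convert this using 1
  congr 1 <;> ring

theorem cs_indep {m s k : ℕ} {f : MvPolynomial (Fin m) ℂ} {T : Type} [CommRing T] [IsDomain T]
    [Algebra ℂ T] (E : CsData (csHf s f) T) (lam : Fin k → ℂ) (hlam : Function.Injective lam)
    (x : Fin k → Fin m → ℂ) (hx : ∀ j, ∑ i, x j i ^ 2 = 1) (P : Fin k → Ideal T)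
    (hP : ∀ j, (P j).IsPrime) (hU : ∀ j, E.U ∈ P j)
    (hev : ∀ j g, E.I g ∈ P j → eval (csPt (x j) (lam j)) g = 0)
    (hl : ∀ j, E.I (X none - C (lam j) * csQ m ^ s) ∈ P j)
    (a : Fin k → Fin (m + 1) → CsS m) (ε : Fin k → Fin (m + 1) → ℕ) (w : Fin k → Fin (m + 1) → T)
    (haw : ∀ j i, E.U ^ ε j i * w j i = E.I (a j i))
    (hind : ∀ j, AlgebraicIndependent ℂ (fun i => Ideal.Quotient.mk (P j) (w j i))) :
    LinearIndependent ℂ (fun y : Fin k × (Fin (m + 1) →₀ ℕ) =>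
      csPhi m s lam y.1 * ∏ i, a y.1 i ^ y.2 i) := by
  classical
  rw [linearIndependent_iff]
  intro l hl0
  by_contra hne
  let r : Fin k × (Fin (m + 1) →₀ ℕ) → ℕ := fun y => ∑ i, ε y.1 i * y.2 i
  let W : Fin k × (Fin (m + 1) →₀ ℕ) → T := fun y => ∏ i, w y.1 i ^ y.2 i
  have hW : ∀ y : Fin k × (Fin (m + 1) →₀ ℕ), E.I (∏ i, a y.1 i ^ y.2 i) = E.U ^ r y * W y := by
    intro y
    simp only [map_prod, map_pow, r, W, ← haw, mul_pow, Finset.prod_mul_distrib, ← pow_mul,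
      Finset.prod_pow_eq_pow_sum]
  obtain ⟨y0, hy0, hmin⟩ := Finset.exists_min_image l.support r (Finsupp.support_nonempty_iff.2 hne)
  set j0 := y0.1 with hj0
  have h1 : ∑ y ∈ l.support, l y • (E.I (csPhi m s lam y.1) * (E.U ^ (r y - r y0) * W y)) = 0 := by
    have h2 := congrArg E.I hl0
    rw [Finsupp.linearCombination_apply, Finsupp.sum, map_sum, map_zero] at h2
    have h3 : E.U ^ r y0 *
        ∑ y ∈ l.support, l y • (E.I (csPhi m s lam y.1) * (E.U ^ (r y - r y0) * W y)) = 0 := by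
      rw [← h2, Finset.mul_sum]
      refine Finset.sum_congr rfl fun y hy => ?_
      rw [map_smul, map_mul, hW, mul_smul_comm]
      have : r y = r y0 + (r y - r y0) := by have := hmin y hy; omega
      conv_rhs => rw [this, pow_add]
      congr 1; ring
    exact (mul_eq_zero.1 h3).resolve_left (pow_ne_zero _ E.U_ne)
  let π : T →ₐ[ℂ] T ⧸ P j0 := Ideal.Quotient.mkₐ ℂ (P j0)
  have hπ : ∀ t, π t = 0 ↔ t ∈ P j0 := fun t => Ideal.Quotient.eq_zero_iff_mem
  have hdom : IsDomain (T ⧸ P j0) := Ideal.Quotient.isDomain _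
  let F := l.support.filter (fun y => y.1 = j0 ∧ r y = r y0)
  have h4 : π (E.I (csPhi m s lam j0)) * ∑ y ∈ F, l y • π (W y) = 0 := by
    have h5 := congrArg π h1
    rw [map_sum, map_zero] at h5
    rw [← h5, Finset.mul_sum, Finset.sum_filter]
    refine Finset.sum_congr rfl fun y hy => ?_
    rw [map_smul, map_mul, map_mul, map_pow]
    split_ifs with hc
    · rw [hc.1, hc.2, Nat.sub_self, pow_zero, one_mul, mul_smul_comm]
    · by_cases hc1 : y.1 = j0
      · have hlt : r y - r y0 ≠ 0 := by
          have := hmin y hy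
          have : r y ≠ r y0 := fun h => hc ⟨hc1, h⟩
          omega
        rw [(hπ E.U).2 (hU j0), zero_pow hlt]; simp
      · have : π (E.I (csPhi m s lam y.1)) = 0 := by
          rw [hπ, csPhi, map_prod]
          refine Ideal.mem_of_dvd _ (Finset.dvd_prod_of_mem _
            (Finset.mem_erase.2 ⟨Ne.symm hc1, Finset.mem_univ j0⟩)) ?_
          rw [csPsi, map_mul]
          exact (P j0).mul_mem_right _ (hl j0)
        rw [this]; simp
  have h6 : π (E.I (csPhi m s lam j0)) ≠ 0 := by
    rw [Ne, hπ]
    intro hm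
    have h7 := hev _ _ hm
    rw [csPhi, map_prod, Finset.prod_eq_zero_iff] at h7
    obtain ⟨j, hj, h8⟩ := h7
    rw [csPsi, map_mul, map_pow, map_sub, map_mul, map_pow, csPt_Q _ _ (hx j0), eval_C, eval_X]
      at h8
    simp only [one_pow, mul_one] at h8
    change lam j0 - lam j = 0 at h8
    exact (Finset.mem_erase.1 hj).1 (hlam (sub_eq_zero.1 h8).symm)
  have h9 : ∑ y ∈ F, l y • π (W y) = 0 := (mul_eq_zero.1 h4).resolve_left h6
  let p : MvPolynomial (Fin (m + 1)) ℂ := ∑ y ∈ F, monomial y.2 (l y)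
  have h10 : aeval (fun i => Ideal.Quotient.mk (P j0) (w j0 i)) p = 0 := by
    rw [← h9, map_sum]
    refine Finset.sum_congr rfl fun y hy => ?_
    have hy1 : y.1 = j0 := (Finset.mem_filter.1 hy).2.1
    rw [aeval_monomial, Algebra.smul_def, Finsupp.prod_fintype _ _ (by simp)]
    congr 1
    simp only [W, map_prod, map_pow, hy1]
    rfl
  have h11 : p = 0 := (injective_iff_map_eq_zero _).1 (hind j0) p h10
  have h12 : coeff y0.2 p = l y0 := by
    rw [coeff_sum, Finset.sum_eq_single y0]
    · simp
    · intro y hy hyne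
      rw [coeff_monomial, if_neg]
      intro h
      exact hyne (Prod.ext (Finset.mem_filter.1 hy).2.1 h)
    · intro h
      exact absurd (Finset.mem_filter.2 ⟨hy0, rfl, rfl⟩) h
  rw [h11, coeff_zero] at h12
  exact (Finsupp.mem_support_iff.1 hy0) h12.symm


theorem cs_card_lower (n q : ℕ) : (q + 1) ^ (n + 1) ≤
    (n + 1).factorial * (Finset.finsuppAntidiag (Finset.univ : Finset (Fin (n + 2))) q).card := by
  rw [Finset.card_finsuppAntidiag_nat_eq_choose]
  simp only [Finset.card_univ, Fintype.card_fin]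
  have h : (n + 2 + q - 1).choose q = (q + (n + 1)).choose (n + 1) := by
    rw [show n + 2 + q - 1 = q + (n + 1) by omega, Nat.choose_symm_add]
  rw [h, ← Nat.ascFactorial_eq_factorial_mul_choose]
  exact Nat.pow_succ_le_ascFactorial _ _

theorem cs_card_upper (n q : ℕ) :
    n.factorial * (Finset.finsuppAntidiag (Finset.univ : Finset (Fin (n + 1))) q).card ≤
    (q + n) ^ n := by
  rw [Finset.card_finsuppAntidiag_nat_eq_choose]
  simp only [Finset.card_univ, Fintype.card_fin]
  have h : (n + 1 + q - 1).choose q = (q + n).choose n := by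
    rw [show n + 1 + q - 1 = q + n by omega, Nat.choose_symm_add]
  rw [h, ← Nat.ascFactorial_eq_factorial_mul_choose]
  exact Nat.ascFactorial_le_pow_add _ _

theorem cs_step (B t n : ℕ) : t * ((n + 1) * B ^ n) + B ^ (n + 1) ≤ (B + t) ^ (n + 1) := by
  induction n with
  | zero => simp; omega
  | succ n ih =>
    have h1 : (B + t) ^ (n + 2) = (B + t) * (B + t) ^ (n + 1) := by ring
    have h2 : (B + t) * (t * ((n + 1) * B ^ n) + B ^ (n + 1)) ≤ (B + t) * (B + t) ^ (n + 1) :=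
      Nat.mul_le_mul_left _ ih
    rw [h1]
    refine le_trans ?_ h2
    have h3 : (B + t) * (t * ((n + 1) * B ^ n) + B ^ (n + 1)) =
      t * ((n + 1 + 1) * B ^ (n + 1)) + B ^ (n + 1 + 1) + t * t * ((n + 1) * B ^ n) := by ring
    rw [h3]; omega

theorem cs_telescope (B t n N : ℕ) :
    t * ((n + 1) * ∑ b ∈ Finset.range N, (B + t * b) ^ n) + B ^ (n + 1) ≤
      (B + t * N) ^ (n + 1) := by
  induction N with
  | zero => simp
  | succ N ih =>
    rw [Finset.sum_range_succ]
    have := cs_step (B + t * N) t n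
    have h3 : B + t * (N + 1) = B + t * N + t := by ring
    rw [h3]
    refine le_trans ?_ this
    rw [mul_add, mul_add]
    omega

theorem cs_limit (k t m c n : ℕ)
    (h : ∀ q : ℕ, t * k * (q + 1) ^ m + (q + c + n) ^ m ≤ (q + c + n + t * (q + c + 1)) ^ m) :
    t * k + 1 ≤ (t + 1) ^ m := by
  have hlim : ∀ A : ℝ, Filter.Tendsto (fun q : ℕ => ((q : ℝ) + A) / q) Filter.atTop (nhds 1) := by
    intro A
    have h1 : Filter.Tendsto (fun q : ℕ => 1 + A / (q : ℝ)) Filter.atTop (nhds (1 + 0)) :=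
      tendsto_const_nhds.add (tendsto_const_div_atTop_nhds_zero_nat A)
    rw [add_zero] at h1
    refine h1.congr' ?_
    filter_upwards [Filter.eventually_gt_atTop 0] with q hq
    have : (q : ℝ) ≠ 0 := by positivity
    field_simp
  have hL := ((hlim 1).pow m).const_mul (t * k : ℝ) |>.add ((hlim (c + n)).pow m)
  have hR := ((hlim (c + n)).add ((hlim (c + 1)).const_mul (t : ℝ))).pow m
  have := le_of_tendsto_of_tendsto hL hR (by
    filter_upwards [Filter.eventually_gt_atTop 0] with q hq
    have hq' : (0 : ℝ) < q := by exact_mod_cast hq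
    have h1 : ((t * k * (q + 1) ^ m + (q + c + n) ^ m : ℕ) : ℝ) ≤
      ((q + c + n + t * (q + c + 1)) ^ m : ℕ) := by exact_mod_cast h q
    push_cast at h1
    have e1 : ((q : ℝ) + (c + n)) / q + t * ((q + (c + 1)) / q) =
      (q + c + n + t * (q + c + 1)) / q := by field_simp; ring
    rw [e1, div_pow, div_pow, div_pow, ← mul_div_assoc, ← add_div]
    gcongr
    rw [← add_assoc]; exact h1)
  have h2 : ((t * k + 1 : ℕ) : ℝ) ≤ ((t + 1) ^ m : ℕ) := by
    push_cast
    simpa [add_comm] using this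
  exact_mod_cast h2


theorem cs_Wset_card (n s q : ℕ) : (csWset (m := n + 1) s q ((2 * s + 1) * q)).Finite ∧
    n.factorial * (csWset (m := n + 1) s q ((2 * s + 1) * q)).ncard ≤
      ∑ b ∈ Finset.range (q + 1), (q + n + 2 * s * b) ^ n := by
  classical
  let S : Finset ((_ : ℕ) × (Fin (n + 1) →₀ ℕ)) := (Finset.range (q + 1)).sigma
    (fun b => Finset.finsuppAntidiag Finset.univ (q + 2 * s * b))
  let g : (Option (Fin (n + 1)) →₀ ℕ) → ((_ : ℕ) × (Fin (n + 1) →₀ ℕ)) :=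
    fun b => ⟨q - b none, b.some⟩
  have hmap : ∀ b ∈ csWset (m := n + 1) s q ((2 * s + 1) * q), g b ∈ (S : Set _) := by
    intro b hb
    obtain ⟨h1, h2⟩ := hb
    simp only [S, g, Finset.coe_sigma, Set.mem_sigma_iff, Finset.mem_coe, Finset.mem_range,
      Finset.mem_finsuppAntidiag, Finsupp.some_apply]
    refine ⟨by omega, ?_, Finset.subset_univ _⟩
    obtain ⟨c, rfl⟩ := Nat.exists_eq_add_of_le h1
    rw [Nat.add_sub_cancel_left]
    have h3 : (2 * s + 1) * (b none + c) = b none + c + 2 * s * c + 2 * s * b none := by ring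
    rw [h3] at h2
    exact Nat.add_right_cancel h2
  have hinj : Set.InjOn g (csWset (m := n + 1) s q ((2 * s + 1) * q)) := by
    intro b hb b' hb' hbb
    have h1 := hb.1
    have h2 := hb'.1
    simp only [g, Sigma.mk.injEq, heq_eq_eq] at hbb
    ext (_ | i)
    · omega
    · have := DFunLike.congr_fun hbb.2 i
      simpa using this
  have hle := Set.ncard_le_ncard_of_injOn g hmap hinj S.finite_toSet
  refine ⟨Set.Finite.of_injOn hmap hinj S.finite_toSet, ?_⟩
  rw [Set.ncard_coe_finset, Finset.card_sigma] at hle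
  refine (Nat.mul_le_mul_left _ hle).trans ?_
  rw [Finset.mul_sum]
  refine Finset.sum_le_sum fun b _ => ?_
  refine (cs_card_upper n _).trans (le_of_eq ?_)
  congr 1; ring

theorem cs_dim {n s q : ℕ} {ι : Type} [Fintype ι] (v : ι → CsS (n + 1))
    (hv : LinearIndependent ℂ v) (hmem : ∀ y, v y ∈ csW (n + 1) s q ((2 * s + 1) * q)) :
    Fintype.card ι ≤ (csWset (m := n + 1) s q ((2 * s + 1) * q)).ncard := by
  classical
  have hfin := (cs_Wset_card n s q).1
  generalize hD : (2 * s + 1) * q = D at *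
  have hli2 : LinearIndependent ℂ (fun y : ι => (⟨v y, hmem y⟩ : csW (n + 1) s q D)) :=
    LinearIndependent.of_comp (csW (n + 1) s q D).subtype hv
  have : Fintype (csWset (m := n + 1) s q D) := hfin.fintype
  let bas : Module.Basis (csWset (m := n + 1) s q D) ℂ (csW (n + 1) s q D) :=
    basisRestrictSupport ℂ _
  have hfd : Module.Finite ℂ (csW (n + 1) s q D) := Module.Finite.of_basis bas
  have h3 := hli2.fintype_card_le_finrank
  rwa [Module.finrank_eq_card_basis bas, ← Nat.card_eq_fintype_card (α := csWset s q D),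
    Nat.card_coe_set_eq] at h3

theorem cs_arith (n s k q q' : ℕ)
    (h3 : k * (Finset.finsuppAntidiag (Finset.univ : Finset (Fin (n + 2))) q).card ≤
      (csWset (m := n + 1) s q' ((2 * s + 1) * q')).ncard) :
    2 * s * k * (q + 1) ^ (n + 1) + (q' + n) ^ (n + 1) ≤
      (q' + n + 2 * s * (q' + 1)) ^ (n + 1) := by
  have hcard := (cs_Wset_card n s q').2
  have h4 := cs_card_lower n q
  generalize (csWset (m := n + 1) s q' ((2 * s + 1) * q')).ncard = N at *
  generalize (Finset.finsuppAntidiag (Finset.univ : Finset (Fin (n + 2))) q).card = g at *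
  have h5 : k * (q + 1) ^ (n + 1) ≤ (n + 1) * ∑ b ∈ Finset.range (q' + 1), (q' + n + 2 * s * b) ^ n :=
    calc k * (q + 1) ^ (n + 1) ≤ k * ((n + 1).factorial * g) := Nat.mul_le_mul_left _ h4
      _ = (n + 1) * (n.factorial * (k * g)) := by rw [Nat.factorial_succ]; ring
      _ ≤ (n + 1) * (n.factorial * N) := Nat.mul_le_mul_left _ (Nat.mul_le_mul_left _ h3)
      _ ≤ _ := Nat.mul_le_mul_left _ hcard
  refine le_trans ?_ (cs_telescope (q' + n) (2 * s) n (q' + 1))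
  rw [mul_assoc (2 * s)]
  exact Nat.add_le_add_right (Nat.mul_le_mul_left _ h5) _

theorem cs_count_aux {n s k : ℕ} (lam : Fin k → ℂ) (a : Fin k → Fin (n + 2) → CsS (n + 1))
    (ha : ∀ j i, a j i ∈ csW (n + 1) s 1 (2 * s + 1))
    (hli : LinearIndependent ℂ (fun y : Fin k × (Fin (n + 2) →₀ ℕ) =>
      csPhi (n + 1) s lam y.1 * ∏ i, a y.1 i ^ y.2 i))
    (q : ℕ) (Γ : Finset (Fin (n + 2) →₀ ℕ)) (hΓ : ∀ γ ∈ Γ, ∑ i, γ i = q) :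
    k * Γ.card ≤ (csWset (m := n + 1) s (q + 2 * (k - 1))
      ((2 * s + 1) * (q + 2 * (k - 1)))).ncard := by
  have hmem : ∀ y : Fin k × (Fin (n + 2) →₀ ℕ), y.2 ∈ Γ →
      csPhi (n + 1) s lam y.1 * ∏ i, a y.1 i ^ y.2 i ∈
      csW (n + 1) s (q + 2 * (k - 1)) ((2 * s + 1) * (q + 2 * (k - 1))) := by
    intro y hyΓ
    have hy := hΓ _ hyΓ
    have h1 := csW_prod (s := s) Finset.univ (fun i => a y.1 i ^ y.2 i)
      (fun i => y.2 i * 1) (fun i => y.2 i * (2 * s + 1))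
      (fun i _ => csW_pow (ha y.1 i) _)
    rw [← Finset.sum_mul, ← Finset.sum_mul, hy] at h1
    have h2 := csW_mul (csPhi_mem (n + 1) s lam y.1) h1
    have e1 : 2 * (k - 1) + q * 1 = q + 2 * (k - 1) := by ring
    have e2 : (2 * s + 1) * (2 * (k - 1)) + q * (2 * s + 1) =
      (2 * s + 1) * (q + 2 * (k - 1)) := by ring
    rw [e1, e2] at h2
    exact h2
  have hcard := cs_dim (ι := Fin k × Γ)
    (fun y => (fun y : Fin k × (Fin (n + 2) →₀ ℕ) =>
      csPhi (n + 1) s lam y.1 * ∏ i, a y.1 i ^ y.2 i) (y.1, y.2.1))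
    (hli.comp (fun y : Fin k × Γ => (y.1, y.2.1)) (by
      rintro ⟨y1, y2⟩ ⟨y1', y2'⟩ h
      simp only [Prod.mk.injEq] at h
      exact Prod.ext h.1 (Subtype.ext h.2)))
    (fun y => hmem (y.1, y.2.1) y.2.2)
  rwa [Fintype.card_prod, Fintype.card_fin, Fintype.card_coe] at hcard

theorem cs_count {n s k : ℕ} (lam : Fin k → ℂ) (a : Fin k → Fin (n + 2) → CsS (n + 1))
    (ha : ∀ j i, a j i ∈ csW (n + 1) s 1 (2 * s + 1))
    (hli : LinearIndependent ℂ (fun y : Fin k × (Fin (n + 2) →₀ ℕ) =>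
      csPhi (n + 1) s lam y.1 * ∏ i, a y.1 i ^ y.2 i)) :
    2 * s * k + 1 ≤ (2 * s + 1) ^ (n + 1) := by
  refine cs_limit k (2 * s) (n + 1) (2 * (k - 1)) n fun q => ?_
  have h3 := cs_count_aux lam a ha hli q (Finset.finsuppAntidiag Finset.univ q)
    (fun γ hγ => (Finset.mem_finsuppAntidiag.1 hγ).1)
  exact cs_arith n s k q _ h3

theorem cs_bound_aux {n s k : ℕ} {f : MvPolynomial (Fin (n + 1)) ℂ} {T : Type} [CommRing T] [IsDomain T]
    [Algebra ℂ T] [Algebra.FiniteType ℂ T] (E : CsData (csHf s f) T)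
    (hf : f.IsHomogeneous (2 * s + 2)) (lam : Fin k → ℂ) (hlam : Function.Injective lam)
    (x : Fin k → Fin (n + 1) → ℂ) (hx : ∀ j, ∑ i, x j i ^ 2 = 1)
    (he : ∀ j i, eval (x j) (pderiv i f) = (2 * s + 2 : ℂ) * lam j * x j i) :
    2 * s * k + 1 ≤ (2 * s + 1) ^ (n + 1) := by
  classical
  choose P hP hU hev hl a ε w ha haw hind using
    fun j => cs_prime E hf (x j) (lam j) (hx j) (he j)
  have hli := cs_indep E lam hlam x hx P hP hU hev hl a ε w haw hind
  exact cs_count lam a ha hli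

theorem cs_bound (n s k : ℕ) (f : MvPolynomial (Fin (n + 1)) ℂ)
    (hf : f.IsHomogeneous (2 * s + 2)) (lam : Fin k → ℂ) (hlam : Function.Injective lam)
    (x : Fin k → Fin (n + 1) → ℂ) (hx : ∀ j, ∑ i, x j i ^ 2 = 1)
    (he : ∀ j i, eval (x j) (pderiv i f) = (2 * s + 2 : ℂ) * lam j * x j i) :
    2 * s * k + 1 ≤ (2 * s + 1) ^ (n + 1) :=
  cs_bound_aux (csData (csHf s f)) hf lam hlam x hx he


/-- (Cartwright–Sturmfels bound, even case) For an even `d ≥ 3`, a homogeneous polynomial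
`f` of degree `d` in `n+1` variables over `ℂ` has finitely many E-eigenvalues, at most
`((d-1)^(n+1) − 1)/(d-2)` of them. -/
theorem cartwright_sturmfels_even
    (n d : ℕ) (hd_even : Even d) (hd : 3 ≤ d)
    (f : MvPolynomial (Fin (n + 1)) ℂ) (hf : f.IsHomogeneous d) :
    ({lam : ℂ | ∃ x : Fin (n + 1) → ℂ, (∑ i, (x i) ^ 2 = 1) ∧
        ∀ i, eval x (pderiv i f) = (d : ℂ) * lam * x i}).Finite ∧
    ({lam : ℂ | ∃ x : Fin (n + 1) → ℂ, (∑ i, (x i) ^ 2 = 1) ∧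
        ∀ i, eval x (pderiv i f) = (d : ℂ) * lam * x i}).ncard
      ≤ ((d - 1) ^ (n + 1) - 1) / (d - 2) := by
  obtain ⟨s, rfl⟩ : ∃ s, d = 2 * s + 2 := by
    obtain ⟨r, rfl⟩ := hd_even
    exact ⟨r - 1, by omega⟩
  have hs : 1 ≤ s := by omega
  set A := {lam : ℂ | ∃ x : Fin (n + 1) → ℂ, (∑ i, (x i) ^ 2 = 1) ∧
    ∀ i, eval x (pderiv i f) = ((2 * s + 2 : ℕ) : ℂ) * lam * x i} with hA
  have key : ∀ F : Finset ℂ, (F : Set ℂ) ⊆ A →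
      F.card ≤ ((2 * s + 2 - 1) ^ (n + 1) - 1) / (2 * s + 2 - 2) := by
    intro F hF
    let e := F.equivFin.symm
    choose x hx he using fun j : Fin F.card => hF (e j).2
    have h1 := cs_bound n s F.card f hf (fun j => (e j : ℂ))
      (Subtype.val_injective.comp e.injective) x hx (by
        intro j i
        rw [he j i]; push_cast; ring)
    rw [show 2 * s + 2 - 1 = 2 * s + 1 by omega, show 2 * s + 2 - 2 = 2 * s by omega,
      Nat.le_div_iff_mul_le (by omega), mul_comm]
    omega
  have hfin : A.Finite := by
    by_contra hinf
    obtain ⟨F, hF, hc⟩ := Set.Infinite.exists_subset_card_eq hinf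
      (((2 * s + 2 - 1) ^ (n + 1) - 1) / (2 * s + 2 - 2) + 1)
    have := key F hF
    omega
  refine ⟨hfin, ?_⟩
  rw [Set.ncard_eq_toFinset_card A hfin]
  exact key _ (by simp)
end

section
/- (Cartwright–Sturmfels bound, odd case) Let d ≥ 3 be odd and let f be a homogeneous polynomial of degree d in the variables x_1,…,x_{n+1} over ℂ. Then the set E of E-eigenvalues of f, namely {λ ∈ ℂ : there exists x ∈ ℂ^{n+1} with Σ_i x_i² = 1 and ∂f/∂x_i(x) = d·λ·x_i for all i}, satisfies: λ ∈ E if and only if −λ ∈ E; moreover E is finite with at most 2·((d-1)^{n+1} − 1)/(d-2) elements, i.e. f has at most ((d-1)^{n+1} − 1)/(d-2) pairs (λ,−λ) of distinct E-eigenvalues. -/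
open MvPolynomial

/-- exponent vectors of total degree at most D -/
def simp_exps (m D : ℕ) : Finset (Fin m → ℕ) :=
  (Fintype.piFinset fun _ => Finset.range (D+1)).filter (fun β => ∑ i, β i ≤ D)

lemma mem_simp_exps {m D : ℕ} {β : Fin m → ℕ} : β ∈ simp_exps m D ↔ ∑ i, β i ≤ D := by
  simp only [simp_exps, Finset.mem_filter, Fintype.mem_piFinset, Finset.mem_range, and_iff_right_iff_imp]
  intro h i
  have := Finset.single_le_sum (f := β) (fun _ _ => Nat.zero_le _) (Finset.mem_univ i)
  omega

lemma card_simp_exps_le (m D : ℕ) : (simp_exps m D).card ≤ (D+1)^m := by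
  refine (Finset.card_filter_le _ _).trans ?_
  simp [Fintype.card_piFinset]

lemma card_simp_exps_mul (m e D δ : ℕ) (he : 1 ≤ e) :
    (simp_exps m (e*D+δ)).card ≤ e^m * (simp_exps m (D+δ)).card := by
  have : (simp_exps m (e*D+δ)).card ≤
      ((Fintype.piFinset fun _ : Fin m => Finset.range e) ×ˢ simp_exps m (D+δ)).card := by
    apply Finset.card_le_card_of_injOn (fun β => (fun i => β i % e, fun i => β i / e))
    · intro β hβ
      have hβ := mem_simp_exps.1 hβ
      simp only [Finset.coe_product, Set.mem_prod, Finset.mem_coe, Fintype.mem_piFinset, Finset.mem_range]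
      refine ⟨fun i => Nat.mod_lt _ he, mem_simp_exps.2 ?_⟩
      have h1 : e * ∑ i, β i / e ≤ ∑ i, β i := by
        rw [Finset.mul_sum]
        exact Finset.sum_le_sum fun i _ => Nat.mul_div_le _ _
      have h2 : e * ∑ i, β i / e ≤ e * (D + δ) := by nlinarith
      exact Nat.le_of_mul_le_mul_left h2 he
    · intro β _ γ _ h
      simp only [Prod.mk.injEq] at h
      funext i
      rw [← Nat.div_add_mod (β i) e, ← Nat.div_add_mod (γ i) e, congrFun h.1 i, congrFun h.2 i]
  simpa [Finset.card_product, Fintype.card_piFinset] using this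

lemma count_bound (m e δ K : ℕ) (he : 1 ≤ e)
    (h : ∀ D, K * (simp_exps m D).card ≤ (simp_exps m (e*D+δ)).card) : K ≤ e^m := by
  by_contra hK
  push Not at hK
  set M := e^m with hM
  have hMpos : 0 < M := by positivity
  have h1 : ∀ D, (M+1) * (simp_exps m D).card ≤ M * (simp_exps m (D+δ)).card := fun D =>
    (Nat.mul_le_mul_right _ hK).trans ((h D).trans (card_simp_exps_mul m e D δ he))
  have h2 : ∀ n, (M+1)^n ≤ M^n * (simp_exps m (n*δ)).card := by
    intro n
    induction n with
    | zero =>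
      simp only [pow_zero, one_mul, zero_mul]
      exact Finset.card_pos.2 ⟨0, mem_simp_exps.2 (by simp)⟩
    | succ n ih =>
      calc (M+1)^(n+1) = (M+1) * (M+1)^n := by ring
        _ ≤ (M+1) * (M^n * (simp_exps m (n*δ)).card) := by gcongr
        _ = M^n * ((M+1) * (simp_exps m (n*δ)).card) := by ring
        _ ≤ M^n * (M * (simp_exps m (n*δ+δ)).card) := Nat.mul_le_mul_left _ (h1 _)
        _ = _ := by rw [show (n+1)*δ = n*δ+δ by ring]; ring
  have h3 : ∀ n : ℕ, 1 ≤ n → (1:ℝ) / (δ+1)^m ≤ (n:ℝ)^m / (((M:ℝ)+1)/M)^n := by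
    intro n hn
    have h4 : (M+1)^n ≤ M^n * (n*(δ+1))^m := by
      refine (h2 n).trans ?_
      gcongr
      refine (card_simp_exps_le _ _).trans ?_
      gcongr
      nlinarith
    have h5 : ((M:ℝ)+1)^n ≤ (M:ℝ)^n * ((n:ℝ)*(δ+1))^m := by exact_mod_cast h4
    have hM' : (0:ℝ) < M := by exact_mod_cast hMpos
    rw [div_pow, div_div_eq_mul_div, div_le_div_iff₀ (by positivity) (by positivity)]
    rw [mul_pow] at h5
    nlinarith
  have hr : (1:ℝ) < ((M:ℝ)+1)/M := by
    have hM' : (0:ℝ) < M := by exact_mod_cast hMpos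
    rw [lt_div_iff₀ hM']; linarith
  have ht := tendsto_pow_const_div_const_pow_of_one_lt m hr
  have hpos : (0:ℝ) < 1/(δ+1)^m := by positivity
  obtain ⟨n, hn1, hn2⟩ := ((ht.eventually_lt_const hpos).and (Filter.eventually_ge_atTop 1)).exists
  exact absurd (h3 n hn2) (not_le.2 hn1)

lemma core_indep {R : Type} [CommRing R] [IsDomain R] [Algebra ℂ R] {ι : Type} [Fintype ι] {m : ℕ}
    (u : R) (hu : u ≠ 0) (q : ι → Ideal R) (hq : ∀ j, (q j).IsPrime) (huq : ∀ j, u ∈ q j)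
    (g : Fin m → R) (hg : ∀ j, AlgebraicIndependent ℂ (fun i => Ideal.Quotient.mk (q j) (g i)))
    (e : ι → R) (he : ∀ i j, i ≠ j → e j ∈ q i) (he' : ∀ j, e j ∉ q j)
    (Q : ι → MvPolynomial (Fin m) (Polynomial ℂ))
    (hQ : ∑ j, e j * eval₂Hom (Polynomial.aeval u : Polynomial ℂ →ₐ[ℂ] R).toRingHom g (Q j) = 0) :
    ∀ j, Q j = 0 := by
  classical
  set Ψ := eval₂Hom (Polynomial.aeval u : Polynomial ℂ →ₐ[ℂ] R).toRingHom g with hΨ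
  have step : ∀ Q : ι → MvPolynomial (Fin m) (Polynomial ℂ), ∑ j, e j * Ψ (Q j) = 0 →
      ∀ j, (C Polynomial.X : MvPolynomial (Fin m) (Polynomial ℂ)) ∣ Q j := by
    intro Q hQ i
    have h1 : e i * Ψ (Q i) ∈ q i := by
      rw [← Finset.add_sum_erase _ _ (Finset.mem_univ i)] at hQ
      rw [eq_neg_of_add_eq_zero_left hQ]
      refine neg_mem (Ideal.sum_mem _ fun j hj => Ideal.mul_mem_right _ _ (he _ _ ?_))
      exact (Finset.ne_of_mem_erase hj).symm
    have h2 : Ψ (Q i) ∈ q i := ((hq i).mem_or_mem h1).resolve_left (he' i)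
    have h3 : aeval (fun k => Ideal.Quotient.mk (q i) (g k)) (map Polynomial.constantCoeff (Q i))
        = Ideal.Quotient.mk (q i) (Ψ (Q i)) := by
      have : ((aeval (fun k => Ideal.Quotient.mk (q i) (g k)) : MvPolynomial (Fin m) ℂ →ₐ[ℂ] _).toRingHom.comp
          (map Polynomial.constantCoeff)) = (Ideal.Quotient.mk (q i)).comp Ψ := by
        apply MvPolynomial.ringHom_ext'
        · apply Polynomial.ringHom_ext
          · intro a
            simp [hΨ]
          · simp [hΨ]
            exact (Ideal.Quotient.eq_zero_iff_mem.2 (huq i)).symm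
        · intro k
          simp [hΨ]
      exact RingHom.congr_fun this (Q i)
    rw [Ideal.Quotient.eq_zero_iff_mem.2 h2] at h3
    have h4 := (algebraicIndependent_iff.1 (hg i)) _ h3
    rw [MvPolynomial.C_dvd_iff_dvd_coeff]
    intro β
    rw [Polynomial.X_dvd_iff]
    have := congrArg (coeff β) h4
    simpa [coeff_map] using this
  have main : ∀ k : ℕ, ∀ Q : ι → MvPolynomial (Fin m) (Polynomial ℂ), ∑ j, e j * Ψ (Q j) = 0 →
      ∀ j, (C (Polynomial.X ^ k) : MvPolynomial (Fin m) (Polynomial ℂ)) ∣ Q j := by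
    intro k
    induction k with
    | zero => intro Q _ j; simp
    | succ k ih =>
      intro Q hQ j
      choose Q' hQ' using step Q hQ
      have h1 : ∑ j, e j * Ψ (Q' j) = 0 := by
        have : u * ∑ j, e j * Ψ (Q' j) = 0 := by
          rw [← hQ, Finset.mul_sum]
          refine Finset.sum_congr rfl fun j _ => ?_
          rw [hQ' j, map_mul]
          have : Ψ (C Polynomial.X) = u := by simp [hΨ]
          rw [this]; ring
        exact (mul_eq_zero.1 this).resolve_left hu
      rw [hQ' j, pow_succ', C_mul]
      exact mul_dvd_mul_left _ (ih Q' h1 j)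
  intro j
  ext1 β
  by_contra h
  have h1 := main ((coeff β (Q j)).natDegree + 1) Q hQ j
  rw [MvPolynomial.C_dvd_iff_dvd_coeff] at h1
  have h2 := Polynomial.natDegree_le_of_dvd (h1 β) h
  simp at h2

lemma core_count {R : Type} [CommRing R] [IsDomain R] [Algebra ℂ R] {ι : Type} [Fintype ι] {m : ℕ}
    (u : R) (hu : u ≠ 0) (q : ι → Ideal R) (hq : ∀ j, (q j).IsPrime) (huq : ∀ j, u ∈ q j)
    (y : Fin m → R)
    (g : Fin m → R) (hg : ∀ j, AlgebraicIndependent ℂ (fun i => Ideal.Quotient.mk (q j) (g i)))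
    (E : ι → MvPolynomial (Fin m) (Polynomial ℂ)) (b : Fin m → MvPolynomial (Fin m) (Polynomial ℂ))
    (e : ℕ) (hepos : 1 ≤ e) (hb : ∀ i, (b i).totalDegree ≤ e)
    (hbg : ∀ i, eval₂Hom (Polynomial.aeval u : Polynomial ℂ →ₐ[ℂ] R).toRingHom y (b i) = u * g i)
    (he : ∀ i j, i ≠ j →
      eval₂Hom (Polynomial.aeval u : Polynomial ℂ →ₐ[ℂ] R).toRingHom y (E j) ∈ q i)
    (he' : ∀ j, eval₂Hom (Polynomial.aeval u : Polynomial ℂ →ₐ[ℂ] R).toRingHom y (E j) ∉ q j) :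
    Fintype.card ι ≤ e ^ m := by
  classical
  set Φ := eval₂Hom (Polynomial.aeval u : Polynomial ℂ →ₐ[ℂ] R).toRingHom y with hΦ
  set δ := Finset.univ.sup (fun j => (E j).totalDegree) with hδ
  refine count_bound m e δ _ hepos fun D => ?_
  set N := e * D + δ
  let w : ι × simp_exps m D → MvPolynomial (Fin m) (Polynomial ℂ) :=
    fun a => E a.1 * ∏ i, b i ^ (a.2.1 i)
  have hw : ∀ a, (w a).totalDegree ≤ N := by
    intro a
    refine (totalDegree_mul _ _).trans ?_
    have h1 : (E a.1).totalDegree ≤ δ := Finset.le_sup (f := fun j => (E j).totalDegree) (Finset.mem_univ a.1)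
    have h2 : (∏ i, b i ^ (a.2.1 i)).totalDegree ≤ e * D := by
      refine (totalDegree_finsetProd _ _).trans ?_
      calc ∑ i, (b i ^ (a.2.1 i)).totalDegree ≤ ∑ i, e * a.2.1 i := by
            refine Finset.sum_le_sum fun i _ => (totalDegree_pow _ _).trans ?_
            rw [mul_comm]
            exact Nat.mul_le_mul_right _ (hb i)
        _ = e * ∑ i, a.2.1 i := by rw [Finset.mul_sum]
        _ ≤ e * D := Nat.mul_le_mul_left _ (mem_simp_exps.1 a.2.2)
    omega
  let T : MvPolynomial (Fin m) (Polynomial ℂ) →ₗ[Polynomial ℂ] (simp_exps m N → Polynomial ℂ) :=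
    LinearMap.pi fun β => MvPolynomial.lcoeff (Polynomial ℂ) (Finsupp.equivFunOnFinite.symm β.1)
  have hli : LinearIndependent (Polynomial ℂ) (fun a => T (w a)) := by
    rw [Fintype.linearIndependent_iff]
    intro c hc
    have h0 : ∑ a, c a • w a = 0 := by
      have h1 : T (∑ a, c a • w a) = 0 := by
        rw [map_sum, ← hc]
        exact Finset.sum_congr rfl fun a _ => map_smul _ _ _
      have h2 : (∑ a, c a • w a).totalDegree ≤ N :=
        totalDegree_finsetSum_le fun a _ => (totalDegree_smul_le _ _).trans (hw a)
      ext1 β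
      by_contra h3
      have h4 : β ∈ (∑ a, c a • w a).support := mem_support_iff.2 h3
      have h5 := (le_totalDegree h4).trans h2
      have h6 : (β : Fin m → ℕ) ∈ simp_exps m N := by
        rw [mem_simp_exps]
        rwa [Finsupp.sum_fintype _ _ (fun _ => rfl)] at h5
      have h7 := congrFun h1 ⟨_, h6⟩
      apply h3
      simpa [T, coeff_sum] using h7
    let Q : ι → MvPolynomial (Fin m) (Polynomial ℂ) := fun j =>
      ∑ β : simp_exps m D, monomial (Finsupp.equivFunOnFinite.symm β.1)
        (c (j, β) * Polynomial.X ^ (∑ i, β.1 i))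
    have hQ : ∀ j, Q j = 0 := by
      apply core_indep u hu q hq huq g hg (fun j => Φ (E j)) he he' Q
      have h1 := congrArg Φ h0
      rw [map_zero, map_sum, Fintype.sum_prod_type] at h1
      rw [← h1]
      refine Finset.sum_congr rfl fun j _ => ?_
      rw [map_sum, Finset.mul_sum]
      refine Finset.sum_congr rfl fun β _ => ?_
      simp only [coe_eval₂Hom, eval₂_monomial, w, smul_eq_C_mul, map_mul, map_prod, map_pow, hbg, mul_pow,
        Finset.prod_mul_distrib, Finset.prod_pow_eq_pow_sum]
      rw [Finsupp.prod_fintype _ _ (fun _ => pow_zero _)]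
      have h2 : Φ (C (c (j, β))) = Polynomial.aeval u (c (j, β)) := by simp [hΦ]
      rw [h2]
      simp
      ring
    rintro ⟨j, β⟩
    have h1 := congrArg (coeff (Finsupp.equivFunOnFinite.symm β.1)) (hQ j)
    simp only [Q, coeff_sum, coeff_monomial, coeff_zero, EmbeddingLike.apply_eq_iff_eq] at h1
    rw [Finset.sum_eq_single β] at h1
    · simpa using h1
    · intro b _ hb
      rw [if_neg]
      exact fun h => hb (Subtype.ext h)
    · simp
  have := hli.fintype_card_le_finrank
  simpa using this

lemma height_two_aux {R : Type*} [CommRing R] [IsDomain R] {P Q : Ideal R} [P.IsPrime] [Q.IsPrime]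
    (hP : P ≠ ⊥) (hPQ : P < Q) : ¬ Q.height ≤ 1 := by
  have h1 := Ideal.height_add_one_le_of_lt_of_isPrime (bot_lt_iff_ne_bot.2 hP)
  have h2 := Ideal.height_add_one_le_of_lt_of_isPrime hPQ
  intro h
  have h3 : (⊥ : Ideal R).height + 1 + 1 ≤ 1 := le_trans (add_le_add_left h1 1) (h2.trans h)
  have h4 : (1 + 1 : ℕ∞) ≤ 1 := le_trans (by simp) h3
  exact absurd h4 (by decide)

lemma indep_mod_principal {s : ℕ} {g : MvPolynomial (Fin s) ℂ} {j : Fin s} (hg0 : g ≠ 0)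
    (hg : degreeOf j g ≠ 0) (p : MvPolynomial (Fin s) ℂ) (hp : degreeOf j p = 0)
    (hpm : p ∈ Ideal.span {g}) : p = 0 := by
  rw [Ideal.mem_span_singleton] at hpm
  obtain ⟨r, rfl⟩ := hpm
  by_contra h
  have hr : r ≠ 0 := fun h' => h (by simp [h'])
  rw [degreeOf_mul_eq hg0 hr] at hp
  omega

lemma trdeg_quot {R : Type} [CommRing R] [IsDomain R] [Algebra ℂ R] [Algebra.FiniteType ℂ R]
    {u : R} (hu : u ≠ 0) (q : Ideal R) (hq : q ∈ (Ideal.span {u}).minimalPrimes) (m : ℕ)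
    (x : Fin (m+1) → R) (hx : AlgebraicIndependent ℂ x) :
    ∃ y : Fin m → R ⧸ q, AlgebraicIndependent ℂ y := by
  have hqp : q.IsPrime := hq.1.1
  have huq : u ∈ q := hq.1.2 (Ideal.mem_span_singleton_self u)
  obtain ⟨s, φ, hφ, hint⟩ := exists_integral_inj_algHom_of_fg ℂ R
  have : IsNoetherianRing R := Algebra.FiniteType.isNoetherianRing ℂ R
  have hht : q.height ≤ 1 := Ideal.height_le_one_of_isPrincipal_of_mem_minimalPrimes _ q hq
  let _ := φ.toRingHom.toAlgebra
  have : IsScalarTower ℂ (MvPolynomial (Fin s) ℂ) R := IsScalarTower.of_algebraMap_eq' φ.comp_algebraMap.symm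
  have : Algebra.IsIntegral (MvPolynomial (Fin s) ℂ) R := ⟨hint⟩
  have : FaithfulSMul (MvPolynomial (Fin s) ℂ) R := (faithfulSMul_iff_algebraMap_injective _ _).2 hφ
  -- s ≥ m+1
  have hs : m + 1 ≤ s := by
    have h1 := trdeg_add_eq ℂ (MvPolynomial (Fin s) ℂ) (A := R)
    have h2 : Algebra.trdeg (MvPolynomial (Fin s) ℂ) R = 0 := by
      have : Algebra.IsAlgebraic (MvPolynomial (Fin s) ℂ) R := inferInstance
      exact trdeg_eq_zero
    have h3 := hx.cardinalMk_le_trdeg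
    rw [← h1, h2] at h3
    simpa using h3
  obtain ⟨s, rfl⟩ : ∃ t, s = t + 1 := ⟨s - 1, by omega⟩
  set n := Ideal.comap (algebraMap (MvPolynomial (Fin (s+1)) ℂ) R) q with hn
  have hnp : n.IsPrime := Ideal.comap_isPrime _ _
  have hn0 : n ≠ ⊥ := Ideal.comap_ne_bot_of_integral_mem hu huq (Algebra.IsIntegral.isIntegral u)
  obtain ⟨g, hgn, hgp⟩ := hnp.exists_mem_prime_of_ne_bot hn0
  have : q.LiesOver n := ⟨rfl⟩
  have hng : n = Ideal.span {g} := by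
    by_contra hne
    have hlt : Ideal.span {g} < n :=
      lt_of_le_of_ne ((Ideal.span_singleton_le_iff_mem _).2 hgn) (Ne.symm hne)
    have : (Ideal.span {g}).IsPrime := (Ideal.span_singleton_prime hgp.ne_zero).2 hgp
    obtain ⟨P, hPq, hP, hPl⟩ := Ideal.exists_ideal_lt_liesOver_of_lt q hlt
    refine height_two_aux ?_ hPq hht
    rintro rfl
    have h5 := hPl.over
    have : g ∈ Ideal.span {g} := Ideal.mem_span_singleton_self g
    rw [h5] at this
    simp [Ideal.under] at this
    exact hgp.ne_zero this
  obtain ⟨j, hj⟩ : ∃ j, degreeOf j g ≠ 0 := by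
    by_contra hcon
    push Not at hcon
    have : totalDegree g = 0 := by
      rw [totalDegree_eq_zero_iff]
      intro m hm x
      have := monomial_le_degreeOf x hm
      have h2 := hcon x
      omega
    rw [totalDegree_eq_zero_iff_eq_C] at this
    have hc : g.coeff 0 ≠ 0 := by
      intro h
      rw [h] at this
      exact hgp.ne_zero (by simpa using this)
    apply hgp.not_isUnit
    rw [this]
    exact (isUnit_iff_ne_zero.2 hc).map C
  have hind : AlgebraicIndependent ℂ (fun i : Fin s => Ideal.Quotient.mk q (φ (X (j.succAbove i)))) := by
    rw [algebraicIndependent_iff]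
    intro p hp
    have h6 : (aeval fun i : Fin s => Ideal.Quotient.mk q (φ (X (j.succAbove i)))) p
        = Ideal.Quotient.mkₐ ℂ q (φ (rename j.succAbove p)) := by
      rw [← AlgHom.comp_apply, ← AlgHom.comp_apply]
      congr 1
      apply MvPolynomial.algHom_ext
      intro i
      simp
    rw [h6] at hp
    have h7 : rename j.succAbove p ∈ n := by
      rw [hn, Ideal.mem_comap]
      exact Ideal.Quotient.eq_zero_iff_mem.1 hp
    rw [hng] at h7
    have h8 := indep_mod_principal hgp.ne_zero hj (rename j.succAbove p) ?_ h7
    · exact (rename_injective _ (Fin.succAbove_right_injective)) (by simpa using h8)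
    · by_contra hne
      have : j ∈ (rename j.succAbove p).vars := by
        by_contra h9
        exact hne (by classical rwa [degreeOf_def, Multiset.count_eq_zero, ← Multiset.mem_toFinset, ← vars_def])
      have := MvPolynomial.vars_rename j.succAbove p this
      simp only [Finset.mem_image] at this
      obtain ⟨a, -, ha⟩ := this
      exact Fin.succAbove_ne j a ha
  exact ⟨_, hind.comp (Fin.castLE (by omega : m ≤ s)) (Fin.castLE_injective _)⟩

lemma exists_generic {ι : Type} [Finite ι] {κ : Type} [Fintype κ] (S : ι → Type)
    [∀ j, CommRing (S j)] [∀ j, IsDomain (S j)] [∀ j, Algebra ℂ (S j)] (x : ∀ j, κ → S j)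
    (hgen : ∀ j, Algebra.adjoin ℂ (Set.range (x j)) = ⊤) (m : ℕ)
    (hind : ∀ j, ∃ y : Fin m → S j, AlgebraicIndependent ℂ y) (k : ℕ) (hk : k ≤ m) :
    ∃ γ : Fin k → κ → ℂ, ∀ j, AlgebraicIndependent ℂ (fun i => ∑ a, γ i a • x j a) := by
  classical
  induction k with
  | zero =>
    refine ⟨fun i => i.elim0, fun j => ?_⟩
    rw [algebraicIndependent_empty_type_iff]
    exact (algebraMap ℂ (S j)).injective
  | succ k ih =>
    obtain ⟨γ, hγ⟩ := ih (by omega)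
    have := Fintype.ofFinite ι
    let A : ∀ j, Subalgebra ℂ (S j) := fun j => Algebra.adjoin ℂ (Set.range fun i => ∑ a, γ i a • x j a)
    let T : ∀ j, (κ → ℂ) →ₗ[ℂ] S j := fun j => Fintype.linearCombination ℂ (x j)
    let Z : ∀ j, Subalgebra ℂ (S j) := fun j =>
      (Subalgebra.algebraicClosure (A j) (S j)).restrictScalars ℂ
    let B : ∀ j, Submodule ℂ (κ → ℂ) := fun j => (Subalgebra.toSubmodule (Z j)).comap (T j)
    have hB : ∀ j, B j ≠ ⊤ := by
      intro j hj
      have h1 : ∀ a, x j a ∈ Z j := by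
        intro a
        have : Pi.single a 1 ∈ B j := by rw [hj]; trivial
        simpa [B, T, Fintype.linearCombination_apply_single] using this
      have h2 : Z j = ⊤ := by
        rw [← top_le_iff, ← hgen j, Algebra.adjoin_le_iff]
        rintro _ ⟨a, rfl⟩
        exact h1 a
      have halg : Algebra.IsAlgebraic (A j) (S j) := by
        constructor
        intro s
        have : s ∈ Z j := by rw [h2]; trivial
        exact this
      have h3 := Algebra.IsAlgebraic.trdeg_le_cardinalMk ℂ (Set.range fun i => ∑ a, γ i a • x j a)
      obtain ⟨y, hy⟩ := hind j
      have h4 := hy.cardinalMk_le_trdeg.trans (h3.trans Cardinal.mk_range_le)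
      simp at h4
      omega
    have hne := Subspace.biUnion_ne_univ_of_top_notMem (s := Finset.univ.image B) (by
      simp only [Finset.mem_image, not_exists]
      rintro j ⟨-, h⟩
      exact hB j h)
    rw [Set.ne_univ_iff_exists_notMem] at hne
    obtain ⟨c, hc⟩ := hne
    simp only [Finset.mem_image, Finset.mem_univ, true_and, Set.iUnion_exists,
      Set.iUnion_iUnion_eq', Set.mem_iUnion, not_exists] at hc
    refine ⟨Fin.cons c γ, fun j => ?_⟩
    have h5 := ((hγ j).option_iff_transcendental (∑ a, c a • x j a)).2 (by
      intro h
      apply hc j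
      exact h)
    have h6 := h5.comp (finSuccEquiv k) (finSuccEquiv k).injective
    convert h6 using 1
    funext i
    refine Fin.cases ?_ (fun i => ?_) i <;> simp

lemma rees_exists_aux (𝕂 : Type) [Field 𝕂] [Algebra (Polynomial ℂ) 𝕂] [Algebra ℂ 𝕂]
    [IsScalarTower ℂ (Polynomial ℂ) 𝕂] [IsFractionRing (Polynomial ℂ) 𝕂] (m : ℕ) (F : Fin m → MvPolynomial (Fin m) ℂ) :
    ∃ (R : Type) (_ : CommRing R) (_ : IsDomain R) (_ : Algebra ℂ R) (u : R) (y v : Fin m → R),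
      u ≠ 0 ∧ (∀ a, u * v a = aeval y (F a)) ∧
      Algebra.adjoin ℂ (insert u (Set.range (Sum.elim y v))) = ⊤ ∧
      AlgebraicIndependent ℂ (Sum.elim y (fun _ : Fin 1 => u)) ∧
      ∀ p : Fin m → ℂ, (∀ a, eval p (F a) = 0) →
        ∃ ψ : R →ₐ[ℂ] ℂ, ψ u = 0 ∧ ∀ i, ψ (y i) = p i := by
  let t : 𝕂 := algebraMap (Polynomial ℂ) 𝕂 Polynomial.X
  have ht : t ≠ 0 := by
    simp only [t]
    exact (map_ne_zero_iff _ (IsFractionRing.injective (Polynomial ℂ) 𝕂)).2 Polynomial.X_ne_zero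
  let yL : Fin m → (MvPolynomial (Fin m) 𝕂) := X
  let uL : (MvPolynomial (Fin m) 𝕂) := C t
  let vL : Fin m → (MvPolynomial (Fin m) 𝕂) := fun a => C t⁻¹ * aeval yL (F a)
  let G : Set (MvPolynomial (Fin m) 𝕂) := insert uL (Set.range (Sum.elim yL vL))
  let R := Algebra.adjoin ℂ G
  have hsub : G ⊆ R := Algebra.subset_adjoin
  let u : R := ⟨uL, hsub (Set.mem_insert _ _)⟩
  let y : Fin m → R := fun i => ⟨yL i, hsub (Set.mem_insert_of_mem _ ⟨Sum.inl i, rfl⟩)⟩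
  let v : Fin m → R := fun i => ⟨vL i, hsub (Set.mem_insert_of_mem _ ⟨Sum.inr i, rfl⟩)⟩
  have hyF : ∀ P : MvPolynomial (Fin m) ℂ, ((aeval y P : R) : (MvPolynomial (Fin m) 𝕂)) = aeval yL P := by
    intro P
    change R.val (aeval y P) = _
    rw [← AlgHom.comp_apply]
    congr 1
    apply MvPolynomial.algHom_ext
    intro i
    simp [y]
  refine ⟨R, inferInstance, inferInstance, inferInstance, u, y, v, ?_, ?_, ?_, ?_, ?_⟩
  · intro h
    have := congrArg Subtype.val h
    simp only [u, uL, ZeroMemClass.coe_zero] at this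
    exact ht (by simpa using this)
  · intro a
    apply Subtype.ext
    rw [hyF]
    change uL * vL a = _
    simp only [uL, vL, ← mul_assoc, ← C_mul, mul_inv_cancel₀ ht, C_1, one_mul]
  · have h1 := Algebra.adjoin_adjoin_coe_preimage (R := ℂ) (s := G)
    rw [← h1]
    congr 1
    ext x
    simp only [G, Set.mem_insert_iff, Set.mem_range, Set.mem_preimage, Sum.exists, Sum.elim_inl, Sum.elim_inr]
    simp only [Subtype.ext_iff, u, y, v]
  · have h1 : AlgebraicIndependent ℂ (fun _ : Fin 1 => t) := by
      have : AlgebraicIndependent ℂ (fun _ : Fin 1 => (Polynomial.X : Polynomial ℂ)) := by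
        rw [algebraicIndependent_unique_type_iff]
        exact Polynomial.transcendental_X ℂ
      exact this.map' (f := IsScalarTower.toAlgHom ℂ (Polynomial ℂ) 𝕂)
        (IsFractionRing.injective (Polynomial ℂ) 𝕂)
    have h2 : AlgebraicIndependent 𝕂 yL := algebraicIndependent_X _ _
    have h3 := h1.sumElim_comp h2
    refine AlgebraicIndependent.of_comp R.val ?_
    convert h3 using 1
    funext i
    rcases i with i | i <;> rfl
  · intro p hp
    have hCC : ∀ c : ℂ, algebraMap (Polynomial ℂ) 𝕂 (Polynomial.C c) = algebraMap ℂ 𝕂 c :=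
      fun c => (IsScalarTower.algebraMap_apply ℂ (Polynomial ℂ) 𝕂 c).symm
    let ev : (MvPolynomial (Fin m) 𝕂) →ₐ[ℂ] 𝕂 := (aeval (R := 𝕂) (fun i => algebraMap ℂ 𝕂 (p i)) : (MvPolynomial (Fin m) 𝕂) →ₐ[𝕂] 𝕂).restrictScalars ℂ
    let inc : Polynomial ℂ →ₐ[ℂ] 𝕂 := IsScalarTower.toAlgHom ℂ (Polynomial ℂ) 𝕂
    have hinc : Function.Injective inc := IsFractionRing.injective (Polynomial ℂ) 𝕂
    have hevF : ∀ P : MvPolynomial (Fin m) ℂ, ev (aeval yL P) = algebraMap ℂ 𝕂 (eval p P) := by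
      intro P
      have : ev.comp (aeval yL) = (Algebra.ofId ℂ 𝕂).comp (aeval p) := by
        apply MvPolynomial.algHom_ext
        intro i
        simp [ev, yL, Algebra.ofId_apply]
      have := AlgHom.congr_fun this P
      simpa using this
    have hle : R ≤ inc.range.comap ev := by
      rw [Algebra.adjoin_le_iff]
      rintro x (rfl | ⟨i | i, rfl⟩)
      · exact ⟨Polynomial.X, by simp [ev, uL, inc, t]⟩
      · exact ⟨Polynomial.C (p i), by simp [ev, yL, inc, hCC]⟩
      · refine ⟨0, ?_⟩
        simp only [Sum.elim_inr, vL]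
        change inc 0 = ev _
        rw [map_mul, hevF, hp]
        simp
    let ψ1 : R →ₐ[ℂ] inc.range := (ev.comp R.val).codRestrict inc.range (fun x => hle x.2)
    let ψ : R →ₐ[ℂ] ℂ := (Polynomial.aeval 0).comp
      (((AlgEquiv.ofInjective inc hinc).symm : inc.range →ₐ[ℂ] Polynomial ℂ).comp ψ1)
    have key : ∀ (r : R) (P : Polynomial ℂ), ev r.1 = inc P → ψ r = P.eval 0 := by
      intro r P h
      have : ψ1 r = AlgEquiv.ofInjective inc hinc P := by
        apply Subtype.ext
        exact h
      simp [ψ, this, Polynomial.coe_aeval_eq_eval]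
    refine ⟨ψ, ?_, fun i => ?_⟩
    · rw [key u Polynomial.X (by simp [ev, u, uL, inc, t])]
      simp
    · rw [key (y i) (Polynomial.C (p i)) (by simp [ev, y, yL, inc, hCC])]
      simp

theorem bezout_sep (m e : ℕ) (hepos : 1 ≤ e) (F : Fin m → MvPolynomial (Fin m) ℂ)
    (hF : ∀ a, (F a).totalDegree ≤ e) {ι : Type} [Fintype ι] (p : ι → Fin m → ℂ)
    (hp : ∀ j a, eval (p j) (F a) = 0)
    (hsep : ∀ Q : Ideal (MvPolynomial (Fin m) ℂ), Q.IsPrime → (∀ a, F a ∈ Q) → ∀ j k,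
      (∀ P ∈ Q, eval (p j) P = 0) → (∀ P ∈ Q, eval (p k) P = 0) → j = k) :
    Fintype.card ι ≤ e ^ m := by
  classical
  obtain ⟨R, i1, i2, i3, u, y, v, hu, huv, hgen, hind, hpt⟩ :=
    rees_exists_aux (FractionRing (Polynomial ℂ)) m F
  choose ψ hψu hψy using fun j => hpt (p j) (hp j)
  have hft : Algebra.FiniteType ℂ R := by
    have hfin : (insert u (Set.range (Sum.elim y v))).Finite := (Set.finite_range _).insert _
    exact ⟨⟨hfin.toFinset, by simpa using hgen⟩⟩
  have hψF : ∀ j P, ψ j (aeval y P) = eval (p j) P := by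
    intro j P
    have : (ψ j).comp (aeval y) = aeval (p j) := by
      apply MvPolynomial.algHom_ext
      intro i
      simp [hψy]
    have := AlgHom.congr_fun this P
    simpa using this
  have hmin : ∀ j, ∃ q ∈ (Ideal.span {u}).minimalPrimes, q ≤ RingHom.ker (ψ j) := by
    intro j
    have : (RingHom.ker (ψ j)).IsPrime := RingHom.ker_isPrime _
    refine Ideal.exists_minimalPrimes_le ?_
    rw [Ideal.span_singleton_le_iff_mem]
    exact hψu j
  choose q hqmin hqker using hmin
  have hq : ∀ j, (q j).IsPrime := fun j => (hqmin j).1.1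
  have huq : ∀ j, u ∈ q j := fun j => (hqmin j).1.2 (Ideal.mem_span_singleton_self u)
  let x : ∀ j, Fin m ⊕ Fin m → R ⧸ q j := fun j a => Ideal.Quotient.mk (q j) (Sum.elim y v a)
  have hx : ∀ j, Algebra.adjoin ℂ (Set.range (x j)) = ⊤ := by
    intro j
    rw [eq_top_iff]
    intro r _
    obtain ⟨r, rfl⟩ := Ideal.Quotient.mk_surjective r
    have hle : Algebra.adjoin ℂ (insert u (Set.range (Sum.elim y v))) ≤
        (Algebra.adjoin ℂ (Set.range (x j))).comap (Ideal.Quotient.mkₐ ℂ (q j)) := by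
      rw [Algebra.adjoin_le_iff]
      rintro w (hw | ⟨a, rfl⟩)
      · rw [hw]
        have : Ideal.Quotient.mkₐ ℂ (q j) u = 0 := Ideal.Quotient.eq_zero_iff_mem.2 (huq j)
        simp only [Subalgebra.coe_comap, Set.mem_preimage, this]
        exact zero_mem _
      · exact Algebra.subset_adjoin ⟨a, rfl⟩
    rw [hgen] at hle
    exact hle (Algebra.mem_top (x := r))
  obtain ⟨γ, hγ⟩ := exists_generic (fun j => R ⧸ q j) x hx m (fun j =>
    trdeg_quot hu (q j) (hqmin j) m _
      (hind.comp finSumFinEquiv.symm finSumFinEquiv.symm.injective)) m le_rfl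
  let g : Fin m → R := fun i => ∑ a, γ i a • Sum.elim y v a
  have hg : ∀ j, AlgebraicIndependent ℂ (fun i => Ideal.Quotient.mk (q j) (g i)) := by
    intro j
    convert hγ j using 1
    funext i
    change Ideal.Quotient.mkₐ ℂ (q j) (g i) = _
    simp only [g, map_sum, map_smul]
    rfl
  -- separating elements
  have hsepel : ∀ i j, i ≠ j → ∃ h : MvPolynomial (Fin m) ℂ, aeval y h ∈ q i ∧ eval (p j) h ≠ 0 := by
    intro i j hij
    by_contra hcon
    push Not at hcon
    refine hij (hsep ((q i).comap (aeval y : MvPolynomial (Fin m) ℂ →ₐ[ℂ] R)) (Ideal.comap_isPrime _ _) ?_ i j ?_ ?_)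
    · intro a
      rw [Ideal.mem_comap]
      change aeval y (F a) ∈ q i
      rw [← huv a]
      exact Ideal.mul_mem_right _ _ (huq i)
    · intro P hP
      rw [← hψF]
      exact hqker i hP
    · intro P hP
      exact hcon P hP
  choose! h hh1 hh2 using hsepel
  let E0 : ι → MvPolynomial (Fin m) ℂ := fun j => ∏ i ∈ Finset.univ.erase j, h i j
  set Φ := eval₂Hom (Polynomial.aeval u : Polynomial ℂ →ₐ[ℂ] R).toRingHom y with hΦ
  have hΦmap : ∀ P : MvPolynomial (Fin m) ℂ, Φ (map Polynomial.C P) = aeval y P := by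
    intro P
    have : Φ.comp (map Polynomial.C) = (aeval y : MvPolynomial (Fin m) ℂ →ₐ[ℂ] R).toRingHom := by
      apply MvPolynomial.ringHom_ext
      · intro c
        simp [hΦ]
      · intro i
        simp [hΦ]
    exact RingHom.congr_fun this P
  refine core_count u hu q hq huq y g hg (fun j => map Polynomial.C (E0 j))
    (fun i => ∑ a, (C (Polynomial.C (γ i (Sum.inl a)) * Polynomial.X) * X a +
      C (Polynomial.C (γ i (Sum.inr a))) * map Polynomial.C (F a))) e hepos ?_ ?_ ?_ ?_
  · intro i
    refine totalDegree_finsetSum_le fun a _ => (totalDegree_add _ _).trans (max_le ?_ ?_)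
    · refine (totalDegree_mul _ _).trans ?_
      rw [totalDegree_C, totalDegree_X, zero_add]
      exact hepos
    · refine (totalDegree_mul _ _).trans ?_
      rw [totalDegree_C, zero_add]
      exact (Finset.sup_mono (support_map_subset _ _)).trans (hF a)
  · intro i
    rw [← hΦ]
    simp only [map_sum, map_add, map_mul, hΦmap, g, Fintype.sum_sum_type, Sum.elim_inl, Sum.elim_inr,
      mul_add, Finset.mul_sum, Finset.sum_add_distrib]
    congr 1 <;> refine Finset.sum_congr rfl fun a _ => ?_
    · simp [hΦ, Algebra.smul_def]
      ring
    · simp only [← huv]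
      simp [hΦ, Algebra.smul_def]
      ring
  · intro i j hij
    rw [← hΦ, hΦmap]
    simp only [E0, map_prod]
    exact Ideal.mem_of_dvd _ (Finset.dvd_prod_of_mem (fun i => aeval y (h i j)) (by simp [hij])) (hh1 i j hij)
  · intro j hj
    rw [← hΦ, hΦmap] at hj
    have h1 : ψ j (aeval y (E0 j)) = 0 := hqker j hj
    rw [hψF] at h1
    simp only [E0, map_prod] at h1
    rw [Finset.prod_eq_zero_iff] at h1
    obtain ⟨i, hi, hi'⟩ := h1
    exact hh2 i j (Finset.ne_of_mem_erase hi) hi'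

lemma smooth_lift {A K B : Type} [CommRing A] [CommRing K] [CommRing B] [Algebra A K]
    [Algebra.FormallySmooth A K] (π : B →+* K) (hπ : Function.Surjective π)
    (hker : IsNilpotent (RingHom.ker π)) (τ : A →+* B) (hτ : ∀ a, π (τ a) = algebraMap A K a) :
    ∃ θ : K →+* B, (∀ k, π (θ k) = k) ∧ ∀ a, θ (algebraMap A K a) = τ a := by
  let _ := τ.toAlgebra
  let g : B →ₐ[A] K := { π with commutes' := hτ }
  refine ⟨(Algebra.FormallySmooth.liftOfSurjective (AlgHom.id A K) g hπ hker : K →ₐ[A] B), ?_, ?_⟩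
  · intro k
    exact Algebra.FormallySmooth.liftOfSurjective_apply (AlgHom.id A K) g hπ hker k
  · intro a
    exact (Algebra.FormallySmooth.liftOfSurjective (AlgHom.id A K) g hπ hker : K →ₐ[A] B).commutes a

open scoped IntermediateField.algebraAdjoinAdjoin in
lemma exists_dual {K : Type} [Field K] [Algebra ℂ K] [Algebra.EssFiniteType ℂ K] (x : K)
    (hx : Transcendental ℂ x) : ∃ θ : K →+* DualNumber K,
      (∀ k, (θ k).fst = k) ∧ (∀ c : ℂ, θ (algebraMap ℂ K c) = algebraMap ℂ _ c) ∧ (θ x).snd = 1 := by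
  have h1 : Algebra.FormallySmooth (Algebra.adjoin ℂ {x}) (IntermediateField.adjoin ℂ {x}) :=
    .of_isLocalization (nonZeroDivisors _)
  have : Algebra.EssFiniteType (IntermediateField.adjoin ℂ {x}) K :=
    Algebra.EssFiniteType.of_comp ℂ _ K
  have h2 : Algebra.FormallySmooth (IntermediateField.adjoin ℂ {x}) K := inferInstance
  have h3 : Algebra.FormallySmooth (Algebra.adjoin ℂ {x}) K :=
    .comp _ (IntermediateField.adjoin ℂ {x}) _
  let eqv := Polynomial.algEquivOfTranscendental ℂ x hx
  let τ : Algebra.adjoin ℂ {x} →ₐ[ℂ] DualNumber K :=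
    (Polynomial.aeval (TrivSqZeroExt.inl x + DualNumber.eps)).comp eqv.symm.toAlgHom
  let π : DualNumber K →ₐ[ℂ] K := TrivSqZeroExt.fstHom ℂ K K
  have hτ : π.comp τ = (Algebra.adjoin ℂ {x}).val := by
    have : (π.comp τ).comp eqv.toAlgHom = (Algebra.adjoin ℂ {x}).val.comp eqv.toAlgHom := by
      apply Polynomial.algHom_ext
      simp [τ, π, eqv]
    apply AlgHom.ext
    intro a
    obtain ⟨b, rfl⟩ := eqv.surjective a
    exact AlgHom.congr_fun this b
  obtain ⟨θ, hθ1, hθ2⟩ := smooth_lift (A := Algebra.adjoin ℂ {x}) (K := K) π.toRingHom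
    TrivSqZeroExt.fst_surjective ⟨2, by
      rw [pow_two, Ideal.zero_eq_bot, eq_bot_iff, Ideal.mul_le]
      intro r hr s hs
      have hr : r.fst = 0 := hr
      have hs : s.fst = 0 := hs
      rw [Ideal.mem_bot]
      ext <;> simp [hr, hs]⟩ τ.toRingHom (AlgHom.congr_fun hτ)
  refine ⟨θ, hθ1, ?_, ?_⟩
  · intro c
    have := hθ2 (algebraMap ℂ _ c)
    exact this.trans (τ.commutes c)
  · have := hθ2 ⟨x, Algebra.subset_adjoin rfl⟩
    have h4 : eqv.symm ⟨x, Algebra.subset_adjoin rfl⟩ = Polynomial.X := by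
      rw [AlgEquiv.symm_apply_eq]
      apply Subtype.ext
      simp [eqv]
    have h5 : θ x = TrivSqZeroExt.inl x + DualNumber.eps := by
      refine this.trans ?_
      change Polynomial.aeval _ (eqv.symm _) = _
      rw [h4]; simp
    rw [h5]; simp

lemma chain_dual {K : Type} [Field K] [Algebra ℂ K] (D : K → K) (hD0 : ∀ c : ℂ, D (algebraMap ℂ K c) = 0)
    (hDa : ∀ a b, D (a + b) = D a + D b) (hDm : ∀ a b, D (a * b) = a * D b + b * D a)
    {m : ℕ} (z : Fin m → K) (f : MvPolynomial (Fin m) ℂ) :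
    D (aeval z f) = ∑ i, aeval z (pderiv i f) * D (z i) := by
  induction f using MvPolynomial.induction_on with
  | C a => simp [hD0]
  | add p q hp hq => simp [hDa, hp, hq, add_mul, Finset.sum_add_distrib]
  | mul_X p j hp =>
    simp only [map_mul, aeval_X, hDm, hp, Derivation.leibniz, smul_eq_mul, map_add, pderiv_X, add_mul,
      Finset.sum_add_distrib, Finset.mul_sum]
    congr 1
    · rw [Finset.sum_eq_single j]
      · simp
      · intro b _ hb
        simp [hb.symm]
      · simp
    · exact Finset.sum_congr rfl fun i _ => by ring

lemma homog_scale {K : Type} [CommRing K] [Algebra ℂ K] {m d : ℕ} {f : MvPolynomial (Fin m) ℂ}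
    (hf : f.IsHomogeneous d) (c : K) (z : Fin m → K) :
    aeval (fun i => c * z i) f = c ^ d * aeval z f := by
  rw [aeval_def, aeval_def, eval₂_eq', eval₂_eq', Finset.mul_sum]
  refine Finset.sum_congr rfl fun β hβ => ?_
  have h1 : ∑ i, β i = d := by
    have := hf (mem_support_iff.1 hβ)
    rw [Finsupp.weight_apply, Finsupp.sum_fintype _ _ (by simp)] at this
    simpa using this
  simp only [mul_pow, Finset.prod_mul_distrib, Finset.prod_pow_eq_pow_sum, h1]
  ring

lemma crit_const {K : Type} [Field K] [Algebra ℂ K] [Algebra.EssFiniteType ℂ K] {m d : ℕ} (hd : 3 ≤ d)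
    {f : MvPolynomial (Fin m) ℂ} (hf : f.IsHomogeneous d) (z : Fin m → K)
    (hz : ∀ i, aeval z (pderiv i f) = (d : K) * z i) :
    ∃ c : ℂ, ∑ i, z i ^ 2 = algebraMap ℂ K c := by
  have hchar : CharZero K := charZero_of_injective_algebraMap (algebraMap ℂ K).injective
  by_cases htr : Transcendental ℂ (∑ i, z i ^ 2)
  · exfalso
    obtain ⟨θ, h1, h2, h3⟩ := exists_dual _ htr
    let D : K → K := fun a => (θ a).snd
    have hD0 : ∀ c : ℂ, D (algebraMap ℂ K c) = 0 := by
      intro c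
      simp only [D, h2]
      rfl
    have hDa : ∀ a b, D (a + b) = D a + D b := by
      intro a b
      simp [D]
    have hDm : ∀ a b, D (a * b) = a * D b + b * D a := by
      intro a b
      simp [D, h1]
      ring
    have hfz : aeval z f = ∑ i, z i ^ 2 := by
      have := congrArg (aeval z) hf.sum_X_mul_pderiv
      simp only [map_sum, map_mul, aeval_X, hz, nsmul_eq_mul, map_natCast] at this
      have hd0 : (d : K) ≠ 0 := by exact_mod_cast (by omega : d ≠ 0)
      apply mul_left_cancel₀ hd0
      rw [← this, Finset.mul_sum]
      exact Finset.sum_congr rfl fun i _ => by ring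
    have h4 := chain_dual D hD0 hDa hDm z f
    have h5 := chain_dual D hD0 hDa hDm z (∑ i, X i ^ 2)
    simp only [hz, hfz] at h4
    have h6 : ∀ i, aeval z (pderiv i (∑ i, X i ^ 2 : MvPolynomial (Fin m) ℂ)) = 2 * z i := by
      intro i
      simp [Derivation.leibniz_pow, pderiv_X]
      rw [Finset.sum_eq_single i]
      · simp
      · intro b _ hb
        simp [hb]
      · simp
    simp only [h6] at h5
    have h7 : D (∑ i, z i ^ 2) = 1 := h3
    have h8 : D (∑ i, z i ^ 2) = ∑ i, 2 * z i * D (z i) := by simpa using h5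
    have h9 : (d : K) = 2 := by
      rw [h7] at h4 h8
      have e1 : (1 : K) = d * ∑ i, z i * D (z i) := by
        rw [h4, Finset.mul_sum]; exact Finset.sum_congr rfl fun i _ => by ring
      have e2 : (1 : K) = 2 * ∑ i, z i * D (z i) := by
        rw [h8, Finset.mul_sum]; exact Finset.sum_congr rfl fun i _ => by ring
      have hne : ∑ i, z i * D (z i) ≠ 0 := by
        intro h; rw [h] at e2; simp at e2
      exact mul_right_cancel₀ hne (e1.symm.trans e2)
    have : d = 2 := by exact_mod_cast h9
    omega
  · rw [Transcendental, not_not] at htr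
    have hint : IsIntegral ℂ (∑ i, z i ^ 2) := htr.isIntegral
    obtain ⟨c, hc⟩ := minpoly.mem_range_of_degree_eq_one ℂ _
      (IsAlgClosed.degree_eq_one_of_irreducible ℂ (minpoly.irreducible hint))
    exact ⟨c, hc.symm⟩

lemma sep_aux1 {K : Type} [Field K] (a b x : K) (k : ℕ) (ha : a ≠ 0) :
    (a ^ k)⁻¹ * a⁻¹ * (b * a ^ k * x) = b * (a⁻¹ * x) := by
  field_simp

lemma sep_aux2 {K : Type} [Field K] (a t : K) (ha : a ≠ 0) :
    t - a⁻¹ ^ 2 * t * a ^ 2 = 0 := by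
  field_simp
  ring

lemma sep_dichotomy {m d : ℕ} (hd : 3 ≤ d) {f : MvPolynomial (Fin m) ℂ} (hf : f.IsHomogeneous d)
    (s : MvPolynomial (Fin m) ℂ) (Q : Ideal (MvPolynomial (Fin m) ℂ)) [hQ : Q.IsPrime]
    (hF : ∀ i, pderiv i f - C (d : ℂ) * s ^ (d - 2) * X i ∈ Q) :
    s ∈ Q ∨ ∃ c : ℂ, (∑ i, X i ^ 2) - C c * s ^ 2 ∈ Q := by
  by_cases hs : s ∈ Q
  · exact Or.inl hs
  right
  let K := FractionRing (MvPolynomial (Fin m) ℂ ⧸ Q)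
  have : Algebra.EssFiniteType ℂ K := by
    have : Algebra.FiniteType ℂ (MvPolynomial (Fin m) ℂ ⧸ Q) := inferInstance
    have : Algebra.EssFiniteType (MvPolynomial (Fin m) ℂ ⧸ Q) K :=
      Algebra.EssFiniteType.of_isLocalization _ (nonZeroDivisors _)
    exact Algebra.EssFiniteType.comp ℂ (MvPolynomial (Fin m) ℂ ⧸ Q) K
  let η : MvPolynomial (Fin m) ℂ →ₐ[ℂ] K :=
    (IsScalarTower.toAlgHom ℂ (MvPolynomial (Fin m) ℂ ⧸ Q) K).comp (Ideal.Quotient.mkₐ ℂ Q)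
  have hη : ∀ P, η P = 0 ↔ P ∈ Q := by
    intro P
    rw [← Ideal.Quotient.eq_zero_iff_mem]
    exact map_eq_zero_iff _ (IsFractionRing.injective (MvPolynomial (Fin m) ℂ ⧸ Q) K)
  have hσ : η s ≠ 0 := fun h => hs ((hη s).1 h)
  have hη' : ∀ P, aeval (fun i => η (X i)) P = η P := by
    intro P
    have : aeval (fun i => η (X i)) = η := by
      apply MvPolynomial.algHom_ext
      simp
    rw [this]
  obtain ⟨c, hc⟩ := crit_const hd hf (fun i => (η s)⁻¹ * η (X i)) (by
    intro i
    have hpd : (pderiv i f).IsHomogeneous (d - 1) := hf.pderiv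
    rw [homog_scale hpd, hη']
    have := (hη _).2 (hF i)
    rw [map_sub, sub_eq_zero] at this
    rw [this]
    simp only [map_mul, map_pow]
    have h1 : η (C (d : ℂ)) = (d : K) := by
      have h3 : η (C (d : ℂ)) = algebraMap ℂ K d := η.commutes (d : ℂ)
      rw [h3, map_natCast]
    rw [h1, show d - 1 = d - 2 + 1 by omega, pow_succ, inv_pow]
    exact sep_aux1 _ _ _ _ hσ)
  refine ⟨c, (hη _).1 ?_⟩
  have h2 : η (C c) = algebraMap ℂ K c := η.commutes c
  simp only [map_sub, map_mul, map_pow, map_sum, h2, ← hc]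
  simp only [mul_pow, ← Finset.mul_sum]
  exact sep_aux2 _ _ hσ

lemma homog_scale_eval {m d : ℕ} {f : MvPolynomial (Fin m) ℂ}
    (hf : f.IsHomogeneous d) (c : ℂ) (z : Fin m → ℂ) :
    eval (fun i => c * z i) f = c ^ d * eval z f := by
  have := homog_scale (K := ℂ) hf c z
  simpa [aeval_eq_eval] using this

lemma count_points {m d : ℕ} (hd : 3 ≤ d) {f : MvPolynomial (Fin m) ℂ} (hf : f.IsHomogeneous d)
    (s : MvPolynomial (Fin m) ℂ) (hs : s.totalDegree ≤ 1) {ι : Type} [Fintype ι] (p : ι → Fin m → ℂ)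
    (hp : ∀ j i, eval (p j) (pderiv i f) = d * (eval (p j) s) ^ (d - 2) * p j i)
    (h1 : ∀ j k, eval (p j) s = 0 → eval (p k) s = 0 → j = k)
    (h2 : ∀ j k (c : ℂ), ∑ i, p j i ^ 2 = c * (eval (p j) s) ^ 2 →
      ∑ i, p k i ^ 2 = c * (eval (p k) s) ^ 2 → j = k) :
    Fintype.card ι ≤ (d - 1) ^ m := by
  refine bezout_sep m (d - 1) (by omega) (fun i => pderiv i f - C (d : ℂ) * s ^ (d - 2) * X i) ?_ p ?_ ?_
  · intro a
    refine (totalDegree_sub _ _).trans (max_le ?_ ?_)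
    · exact (hf.pderiv (i := a)).totalDegree_le
    · refine (totalDegree_mul _ _).trans ?_
      rw [totalDegree_X]
      have h3 := totalDegree_mul (C (d : ℂ)) (s ^ (d - 2))
      rw [totalDegree_C, zero_add] at h3
      have h4 := totalDegree_pow s (d - 2)
      have h5 : (d - 2) * s.totalDegree ≤ (d - 2) * 1 := Nat.mul_le_mul_left _ hs
      omega
  · intro j a
    simp [hp]
  · intro Q hQ hF j k hj hk
    rcases sep_dichotomy hd hf s Q hF with h | ⟨c, h⟩
    · exact h1 j k (hj _ h) (hk _ h)
    · have e1 := hj _ h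
      have e2 := hk _ h
      simp only [map_sub, map_sum, map_pow, map_mul, eval_X, eval_C, sub_eq_zero] at e1 e2
      exact h2 j k c e1 e2

lemma count_points_one {m d : ℕ} (hd : 3 ≤ d) {f : MvPolynomial (Fin m) ℂ} (hf : f.IsHomogeneous d)
    {κ : Type} [Fintype κ] (y : κ → Fin m → ℂ)
    (hy : ∀ j i, eval (y j) (pderiv i f) = d * y j i)
    (hinj : ∀ j k, ∑ i, y j i ^ 2 = ∑ i, y k i ^ 2 → j = k) :
    Fintype.card κ ≤ (d - 1) ^ m := by
  refine count_points hd hf 1 (by simp) y ?_ ?_ ?_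
  · intro j i
    simp [hy]
  · intro j k h
    simp at h
  · intro j k c h h'
    exact hinj j k (by rw [h, h']; simp)

lemma count_points_zero {m d : ℕ} (hd : 3 ≤ d) {f : MvPolynomial (Fin m) ℂ} (hf : f.IsHomogeneous d)
    {κ : Type} [Fintype κ] (y : κ → Fin m → ℂ)
    (hy : ∀ j i, eval (y j) (pderiv i f) = d * y j i)
    (hinj : ∀ j k, ∑ i, y j i ^ 2 = ∑ i, y k i ^ 2 → j = k)
    (x0 : Fin m → ℂ) (hx0 : ∑ i, x0 i ^ 2 = 1) (hx0' : ∀ i, eval x0 (pderiv i f) = 0) :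
    Fintype.card κ + 1 ≤ (d - 1) ^ m := by
  classical
  let l : κ → ℂ := fun k => ∑ i, x0 i * y k i
  obtain ⟨α, hα⟩ := Infinite.exists_notMem_finset (insert 0 (Finset.univ.image fun k => - (l k)⁻¹))
  simp only [Finset.mem_insert, Finset.mem_image, Finset.mem_univ, true_and, not_or, not_exists] at hα
  obtain ⟨hα0, hα1⟩ := hα
  have hne : ∀ k, 1 + α * l k ≠ 0 := by
    intro k h
    apply hα1 k
    have hl : l k ≠ 0 := by
      intro h'; rw [h'] at h; simp at h
    field_simp
    linear_combination -h
  let s : MvPolynomial (Fin m) ℂ := 1 - C α * ∑ i, C (x0 i) * X i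
  have hs : ∀ z : Fin m → ℂ, eval z s = 1 - α * ∑ i, x0 i * z i := by
    intro z
    simp [s]
  let p : Option κ → Fin m → ℂ := fun o => o.elim (fun i => α⁻¹ * x0 i) (fun k i => (1 + α * l k)⁻¹ * y k i)
  have hsn : eval (p none) s = 0 := by
    rw [hs]
    have : ∑ i, x0 i * p none i = α⁻¹ * ∑ i, x0 i ^ 2 := by
      rw [Finset.mul_sum]
      exact Finset.sum_congr rfl fun i _ => by simp only [p, Option.elim]; ring
    rw [this, hx0]
    field_simp
    ring
  have hss : ∀ k, eval (p (some k)) s = (1 + α * l k)⁻¹ := by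
    intro k
    rw [hs]
    have : ∑ i, x0 i * p (some k) i = (1 + α * l k)⁻¹ * l k := by
      simp only [l]
      rw [Finset.mul_sum]
      exact Finset.sum_congr rfl fun i _ => by simp only [p, Option.elim, l]; ring
    rw [this]
    have := hne k
    field_simp
    ring
  have hqn : ∑ i, p none i ^ 2 = (α⁻¹) ^ 2 := by
    simp only [p, Option.elim, mul_pow, ← Finset.mul_sum, hx0, mul_one]
  have hqs : ∀ k, ∑ i, p (some k) i ^ 2 = (∑ i, y k i ^ 2) * ((1 + α * l k)⁻¹) ^ 2 := by
    intro k
    simp only [p, Option.elim, mul_pow, ← Finset.mul_sum]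
    ring
  have hd2 : d - 1 = d - 2 + 1 := by omega
  have := count_points hd hf s ?_ p ?_ ?_ ?_
  · simpa using this
  · refine (totalDegree_sub _ _).trans (max_le (by simp) ?_)
    refine (totalDegree_mul _ _).trans ?_
    rw [totalDegree_C, zero_add]
    refine totalDegree_finsetSum_le fun i _ => (totalDegree_mul _ _).trans ?_
    simp [totalDegree_X]
  · rintro (_ | k) i
    · rw [hsn, zero_pow (by omega)]
      simp only [p, Option.elim]
      rw [homog_scale_eval hf.pderiv, hx0']
      simp
    · rw [hss]
      simp only [p, Option.elim]
      rw [homog_scale_eval hf.pderiv, hy, hd2, pow_succ]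
      ring
  · rintro (_ | j) (_ | k) h h'
    · rfl
    · rw [hss] at h'; exact absurd h' (inv_ne_zero (hne k))
    · rw [hss] at h; exact absurd h (inv_ne_zero (hne j))
    · rw [hss] at h; exact absurd h (inv_ne_zero (hne j))
  · rintro (_ | j) (_ | k) c h h'
    · rfl
    · rw [hqn, hsn] at h
      simp [hα0] at h
    · rw [hqn, hsn] at h'
      simp [hα0] at h'
    · rw [hqs, hss] at h h'
      have e1 := mul_right_cancel₀ (pow_ne_zero 2 (inv_ne_zero (hne j))) h
      have e2 := mul_right_cancel₀ (pow_ne_zero 2 (inv_ne_zero (hne k))) h'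
      rw [hinj j k (e1.trans e2.symm)]

lemma eig_rescale {m d : ℕ} (hd_odd : Odd d) (hd : 3 ≤ d) {f : MvPolynomial (Fin m) ℂ}
    (hf : f.IsHomogeneous d) (x : Fin m → ℂ) (lam rho : ℂ) (hl : lam ≠ 0)
    (hx : ∑ i, x i ^ 2 = 1) (hx' : ∀ i, eval x (pderiv i f) = d * lam * x i)
    (hr : rho ^ (d - 2) = (lam ^ 2)⁻¹) :
    ∃ y : Fin m → ℂ, (∀ i, eval y (pderiv i f) = d * y i) ∧ ∑ i, y i ^ 2 = rho := by
  have hodd : Odd (d - 2) := by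
    obtain ⟨k, hk⟩ := hd_odd
    exact ⟨k - 1, by omega⟩
  obtain ⟨c, hc, hcl⟩ : ∃ c : ℂ, c ^ 2 = rho ∧ c ^ (d - 2) = lam⁻¹ := by
    obtain ⟨c, hc⟩ := IsAlgClosed.exists_pow_nat_eq rho (n := 2) (by norm_num)
    have h1 : (c ^ (d - 2)) ^ 2 = (lam⁻¹) ^ 2 := by
      rw [← pow_mul, mul_comm, pow_mul, hc, hr, inv_pow]
    rcases sq_eq_sq_iff_eq_or_eq_neg.1 h1 with h | h
    · exact ⟨c, hc, h⟩
    · exact ⟨-c, by rw [neg_sq, hc], by rw [hodd.neg_pow, h, neg_neg]⟩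
  refine ⟨fun i => c * x i, fun i => ?_, ?_⟩
  · rw [homog_scale_eval hf.pderiv, hx', show d - 1 = d - 2 + 1 by omega, pow_succ, hcl]
    field_simp
  · simp only [mul_pow, ← Finset.mul_sum, hx, hc, mul_one]

lemma bound_W {m d : ℕ} (hd_odd : Odd d) (hd : 3 ≤ d) {f : MvPolynomial (Fin m) ℂ}
    (hf : f.IsHomogeneous d) (W : Finset ℂ) (hW0 : (0 : ℂ) ∉ W)
    (hW : ∀ mu ∈ W, ∃ (lam : ℂ) (x : Fin m → ℂ), lam ^ 2 = mu ∧ ∑ i, x i ^ 2 = 1 ∧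
      ∀ i, eval x (pderiv i f) = d * lam * x i) :
    (d - 2) * W.card + 1 ≤ (d - 1) ^ m ∧
    ((∃ x0 : Fin m → ℂ, ∑ i, x0 i ^ 2 = 1 ∧ ∀ i, eval x0 (pderiv i f) = 0) →
      (d - 2) * W.card + 2 ≤ (d - 1) ^ m) := by
  classical
  choose r hr using fun mu : ℂ => IsAlgClosed.exists_pow_nat_eq (mu⁻¹) (n := d - 2) (by omega)
  have hζ := Complex.isPrimitiveRoot_exp (d - 2) (by omega)
  set ζ := Complex.exp (2 * Real.pi * Complex.I / ((d - 2 : ℕ) : ℂ)) with hζd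
  let rho : W × Fin (d - 2) → ℂ := fun a => r a.1 * ζ ^ (a.2 : ℕ)
  have hrho : ∀ a, rho a ^ (d - 2) = (a.1 : ℂ)⁻¹ := by
    intro a
    simp only [rho]
    rw [mul_pow, hr, ← pow_mul, mul_comm (a.2 : ℕ), pow_mul, hζ.pow_eq_one, one_pow, mul_one]
  have hmu : ∀ a : W × Fin (d - 2), (a.1 : ℂ) ≠ 0 := fun a h => hW0 (h ▸ a.1.2)
  have hrho0 : ∀ a, rho a ≠ 0 := by
    intro a h
    have := hrho a
    rw [h, zero_pow (by omega)] at this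
    exact inv_ne_zero (hmu a) this.symm
  have hrinj : Function.Injective rho := by
    rintro ⟨a, i⟩ ⟨b, j⟩ h
    have h1 := hrho (a, i)
    rw [h, hrho (b, j)] at h1
    have h2 : a = b := Subtype.ext (inv_injective h1.symm)
    subst h2
    have h3 : r a ≠ 0 := by
      intro h'
      exact hrho0 (a, i) (by simp [rho, h'])
    have h4 : ζ ^ (i : ℕ) = ζ ^ (j : ℕ) := mul_left_cancel₀ h3 h
    have h5 := hζ.pow_inj i.2 j.2 h4
    rw [Fin.ext h5]
  have hex : ∀ a, ∃ y : Fin m → ℂ, (∀ i, eval y (pderiv i f) = d * y i) ∧ ∑ i, y i ^ 2 = rho a := by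
    intro a
    obtain ⟨lam, x, hl, hx, hx'⟩ := hW a.1 a.1.2
    refine eig_rescale hd_odd hd hf x lam (rho a) ?_ hx hx' (by rw [hrho, hl])
    rintro rfl
    exact hmu a (by rw [← hl]; simp)
  choose y hy hyq using hex
  let Y : Option (W × Fin (d - 2)) → Fin m → ℂ := fun o => o.elim 0 y
  have hY : ∀ j i, eval (Y j) (pderiv i f) = d * Y j i := by
    rintro (_ | a) i
    · have h1 := homog_scale_eval (hf.pderiv (i := i)) 0 (0 : Fin m → ℂ)
      rw [zero_pow (by omega), zero_mul] at h1
      simp only [mul_zero, Pi.zero_apply] at h1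
      simp only [Y, Option.elim, Pi.zero_apply, mul_zero]
      exact h1
    · exact hy a i
  have hYq0 : ∑ i, Y none i ^ 2 = 0 := by simp [Y]
  have hYq : ∀ a, ∑ i, Y (some a) i ^ 2 = rho a := fun a => hyq a
  have hinj : ∀ j k, ∑ i, Y j i ^ 2 = ∑ i, Y k i ^ 2 → j = k := by
    rintro (_ | a) (_ | b) h
    · rfl
    · rw [hYq0, hYq] at h; exact absurd h.symm (hrho0 b)
    · rw [hYq0, hYq] at h; exact absurd h (hrho0 a)
    · rw [hYq, hYq] at h
      rw [hrinj h]
  have hcard : Fintype.card (Option (W × Fin (d - 2))) = (d - 2) * W.card + 1 := by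
    simp [mul_comm]
  refine ⟨?_, ?_⟩
  · rw [← hcard]
    exact count_points_one hd hf Y hY hinj
  · rintro ⟨x0, h1, h2⟩
    have := count_points_zero hd hf Y hY hinj x0 h1 h2
    rw [hcard] at this
    exact this

lemma bound_V {m d : ℕ} (hd_odd : Odd d) (hd : 3 ≤ d) {f : MvPolynomial (Fin m) ℂ}
    (hf : f.IsHomogeneous d) (V : Finset ℂ)
    (hV : ∀ lam ∈ V, ∃ x : Fin m → ℂ, (∑ i, (x i) ^ 2 = 1) ∧
        ∀ i, eval x (pderiv i f) = (d : ℂ) * lam * x i) :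
    V.card ≤ 2 * (((d - 1) ^ m - 1) / (d - 2)) := by
  classical
  set W := (V.erase 0).image (fun z => z ^ 2) with hWd
  have hcard : (V.erase 0).card ≤ 2 * W.card := by
    refine Finset.card_le_mul_card_image _ 2 ?_
    intro b hb
    obtain ⟨a, ha, rfl⟩ := Finset.mem_image.1 hb
    have : (V.erase 0).filter (fun z => z ^ 2 = a ^ 2) ⊆ {a, -a} := by
      intro z hz
      simp only [Finset.mem_filter] at hz
      simpa using sq_eq_sq_iff_eq_or_eq_neg.1 hz.2
    exact (Finset.card_le_card this).trans Finset.card_le_two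
  obtain ⟨h1, h2⟩ := bound_W hd_odd hd hf W (by
      simp [hWd]) (by
      intro mu hmu
      obtain ⟨a, ha, rfl⟩ := Finset.mem_image.1 hmu
      obtain ⟨x, hx, hx'⟩ := hV a (Finset.mem_of_mem_erase ha)
      exact ⟨a, x, rfl, hx, hx'⟩)
  obtain ⟨k, rfl⟩ : ∃ k, d = k + 3 := ⟨d - 3, by omega⟩
  have e1 : k + 3 - 1 = k + 2 := by omega
  have e2 : k + 3 - 2 = k + 1 := by omega
  simp only [e1, e2] at h1 h2 ⊢
  have hdvd : (k + 1) ∣ (k + 2) ^ m - 1 := by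
    have := Nat.sub_dvd_pow_sub_pow (k + 2) 1 m
    simpa using this
  obtain ⟨N, hN⟩ := hdvd
  rw [hN, Nat.mul_div_cancel_left _ (by omega)]
  have hpos : 1 ≤ (k + 2) ^ m := Nat.one_le_pow _ _ (by omega)
  have hWN : W.card ≤ N := by
    have : (k + 1) * W.card ≤ (k + 1) * N := by omega
    exact Nat.le_of_mul_le_mul_left this (by omega)
  by_cases h0 : (0 : ℂ) ∈ V
  · obtain ⟨x0, hx0, hx0'⟩ := hV 0 h0
    have h3 := h2 ⟨x0, hx0, fun i => by rw [hx0']; ring⟩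
    have hWN' : W.card < N := by
      have : (k + 1) * W.card < (k + 1) * N := by omega
      exact Nat.lt_of_mul_lt_mul_left this
    have := Finset.card_erase_of_mem h0
    omega
  · rw [Finset.erase_eq_of_notMem h0] at hcard
    omega


/-- (Cartwright–Sturmfels bound, odd case) For an odd `d ≥ 3`, the set `E` of
E-eigenvalues of a homogeneous polynomial `f` of degree `d` in `n+1` variables over `ℂ`
is symmetric (`λ ∈ E ↔ −λ ∈ E`) and finite with at most `2·((d-1)^(n+1) − 1)/(d-2)`
elements, i.e. at most `((d-1)^(n+1) − 1)/(d-2)` pairs `(λ, −λ)`. -/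
theorem cartwright_sturmfels_odd
    (n d : ℕ) (hd_odd : Odd d) (hd : 3 ≤ d)
    (f : MvPolynomial (Fin (n + 1)) ℂ) (hf : f.IsHomogeneous d) :
    (∀ lam : ℂ,
      lam ∈ {mu : ℂ | ∃ x : Fin (n + 1) → ℂ, (∑ i, (x i) ^ 2 = 1) ∧
        ∀ i, eval x (pderiv i f) = (d : ℂ) * mu * x i}
      ↔ -lam ∈ {mu : ℂ | ∃ x : Fin (n + 1) → ℂ, (∑ i, (x i) ^ 2 = 1) ∧
        ∀ i, eval x (pderiv i f) = (d : ℂ) * mu * x i}) ∧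
    ({mu : ℂ | ∃ x : Fin (n + 1) → ℂ, (∑ i, (x i) ^ 2 = 1) ∧
        ∀ i, eval x (pderiv i f) = (d : ℂ) * mu * x i}).Finite ∧
    ({mu : ℂ | ∃ x : Fin (n + 1) → ℂ, (∑ i, (x i) ^ 2 = 1) ∧
        ∀ i, eval x (pderiv i f) = (d : ℂ) * mu * x i}).ncard
      ≤ 2 * (((d - 1) ^ (n + 1) - 1) / (d - 2)) := by
  have hsymm : ∀ lam : ℂ,
      lam ∈ {mu : ℂ | ∃ x : Fin (n + 1) → ℂ, (∑ i, (x i) ^ 2 = 1) ∧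
        ∀ i, eval x (pderiv i f) = (d : ℂ) * mu * x i}
      → -lam ∈ {mu : ℂ | ∃ x : Fin (n + 1) → ℂ, (∑ i, (x i) ^ 2 = 1) ∧
        ∀ i, eval x (pderiv i f) = (d : ℂ) * mu * x i} := by
    rintro lam ⟨x, hx, hx'⟩
    refine ⟨fun i => (-1) * x i, ?_, fun i => ?_⟩
    · refine (Finset.sum_congr rfl fun i _ => ?_).trans hx
      ring
    · have heven : Even (d - 1) := by
        obtain ⟨k, hk⟩ := hd_odd
        exact ⟨k, by omega⟩
      rw [homog_scale_eval hf.pderiv, hx', heven.neg_one_pow]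
      ring
  have hfin : ({mu : ℂ | ∃ x : Fin (n + 1) → ℂ, (∑ i, (x i) ^ 2 = 1) ∧
        ∀ i, eval x (pderiv i f) = (d : ℂ) * mu * x i}).Finite := by
    by_contra hinf
    obtain ⟨V, hV, hVc⟩ := Set.Infinite.exists_subset_card_eq hinf
      (2 * (((d - 1) ^ (n + 1) - 1) / (d - 2)) + 1)
    have := bound_V hd_odd hd hf V (fun lam h => hV h)
    omega
  refine ⟨fun lam => ⟨hsymm lam, fun h => ?_⟩, hfin, ?_⟩
  · simpa using hsymm (-lam) h
  · rw [Set.ncard_eq_toFinset_card _ hfin]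
    exact bound_V hd_odd hd hf _ (fun lam h => by simpa using h)
end

section
/- Let d ≥ 3 and let f be a homogeneous polynomial of degree d in the variables x_1,…,x_{n+1} over ℂ such that the projective hypersurface {f = 0} is smooth, i.e. ∂f/∂x_i(x) = 0 for all i implies x = 0. Then f has only finitely many isotropic eigenvectors up to scaling: the set of one-dimensional complex subspaces ℂ·x of ℂ^{n+1} spanned by vectors x ≠ 0 with Σ_i x_i² = 0 and ∂f/∂x_i(x) = d·λ·x_i for all i (for some λ ∈ ℂ) is finite. -/
open MvPolynomial

theorem aux_finite_of_reduction {σ : Type} [Fintype σ] (V : Set (σ → ℂ)) (N : ℕ)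
    (r : σ → MvPolynomial σ ℂ) (hr : ∀ j, (r j).totalDegree < N)
    (hV : ∀ x ∈ V, ∀ j, x j ^ N = eval x (r j)) : V.Finite := by
  classical
  let φ : MvPolynomial σ ℂ →ₗ[ℂ] (V → ℂ) :=
    { toFun := fun p x => eval x.1 p
      map_add' := fun p q => by ext x; simp
      map_smul' := fun c p => by ext x; simp [smul_eval] }
  let M := Fintype.card σ * N
  let F : Submodule ℂ (V → ℂ) := (restrictTotalDegree σ ℂ M).map φ
  have key : ∀ k : ℕ, ∀ p : MvPolynomial σ ℂ, p.totalDegree ≤ k → φ p ∈ F := by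
    intro k
    induction k using Nat.strong_induction_on with
    | _ k ih =>
      intro p hp
      rw [p.as_sum, map_sum]
      refine Submodule.sum_mem _ fun m hm => ?_
      have hmk : (m.sum fun _ e => e) ≤ k := (le_totalDegree hm).trans hp
      by_cases hM : (m.sum fun _ e => e) ≤ M
      · refine Submodule.mem_map_of_mem ?_
        rw [mem_restrictTotalDegree]
        exact (totalDegree_monomial_le _ _).trans hM
      · obtain ⟨j, hj⟩ : ∃ j, N ≤ m j := by
          by_contra! hcon
          apply hM
          rw [Finsupp.sum_fintype _ _ (fun _ => rfl)]
          calc ∑ i, m i ≤ ∑ _i : σ, N := Finset.sum_le_sum fun i _ => (hcon i).le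
            _ = M := by simp [M]
        have hm' : m = Finsupp.single j N + (m - Finsupp.single j N) := by
          rw [add_tsub_cancel_of_le]
          simpa using hj
        set m' := m - Finsupp.single j N
        have hdeg : (m.sum fun _ e => e) = N + m'.sum fun _ e => e := by
          rw [hm', Finsupp.sum_add_index' (fun _ => rfl) (fun _ _ _ => rfl),
            Finsupp.sum_single_index rfl]
        have heq : φ (monomial m (coeff m p)) = φ (r j * monomial m' (coeff m p)) := by
          ext x
          change eval x.1 _ = eval x.1 _
          rw [map_mul, ← hV x.1 x.2 j]
          generalize coeff m p = a
          have h5 : monomial m a = X j ^ N * monomial m' a := by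
            rw [X_pow_eq_monomial, monomial_mul, one_mul, ← hm']
          rw [h5]
          simp
        rw [heq]
        have h1 : (r j * monomial m' (coeff m p)).totalDegree < k := by
          have := totalDegree_mul (r j) (monomial m' (coeff m p))
          have h2 := totalDegree_monomial_le m' (coeff m p)
          have h3 := hr j
          have h4 : (m'.sum fun _ => id) = m'.sum fun _ e => e := rfl
          omega
        exact ih _ h1 _ le_rfl
  have hfin : FiniteDimensional ℂ F := by
    have : Module.Finite ℂ (restrictTotalDegree σ ℂ M) := inferInstance
    exact Module.Finite.map _ _
  have hroot : ∀ j, ∃ q : Polynomial ℂ, q ≠ 0 ∧ ∀ x ∈ V, q.eval (x j) = 0 := by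
    intro j
    let ψ : Polynomial ℂ →ₗ[ℂ] F := LinearMap.codRestrict F
      (φ ∘ₗ (Polynomial.aeval (X j : MvPolynomial σ ℂ)).toLinearMap) (fun q => key _ _ le_rfl)
    have hni : ¬ Function.Injective ψ := by
      intro hinj
      have := Module.Finite.of_injective ψ hinj
      exact Polynomial.not_finite this
    rw [← LinearMap.ker_eq_bot, Submodule.eq_bot_iff] at hni
    push Not at hni
    obtain ⟨q, hq, hq0⟩ := hni
    refine ⟨q, hq0, fun x hx => ?_⟩
    have h := congrFun (congrArg Subtype.val (LinearMap.mem_ker.1 hq)) ⟨x, hx⟩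
    change eval x (Polynomial.aeval (X j : MvPolynomial σ ℂ) q) = 0 at h
    rw [Polynomial.aeval_def, Polynomial.hom_eval₂] at h
    simpa [Polynomial.eval, Polynomial.eval₂_eq_sum] using h
  choose q hq0 hq using hroot
  refine (Set.Finite.pi' (t := fun j => {z | z ∈ (q j).roots})
    (fun j => Multiset.finite_toSet _)).subset fun x hx j => ?_
  simpa using ⟨hq0 j, hq j x hx⟩

attribute [local instance] MvPolynomial.gradedAlgebra in
theorem aux_reduction {σ : Type} [Fintype σ] (e : ℕ) (he : 2 ≤ e)
    (g : σ → MvPolynomial σ ℂ) (hg : ∀ i, (g i).IsHomogeneous e)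
    (h0 : ∀ x : σ → ℂ, (∀ i, eval x (g i) = 0) → x = 0) :
    {x : σ → ℂ | ∀ i, eval x (g i) = x i}.Finite := by
  classical
  have hnull : ∀ j, ∃ N, (X j : MvPolynomial σ ℂ) ^ N ∈ Ideal.span (Set.range g) := by
    intro j
    change X j ∈ (Ideal.span (Set.range g)).radical
    rw [← vanishingIdeal_zeroLocus_eq_radical (K := ℂ), zeroLocus_span]
    intro x hx
    have : x = 0 := h0 x fun i => by
      have := hx (g i) ⟨i, rfl⟩
      simpa [aeval_eq_eval] using this
    simp [this]
  choose N0 hN0 using hnull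
  let N := e + ∑ j, N0 j
  have hN : ∀ j, (X j : MvPolynomial σ ℂ) ^ N ∈ Ideal.span (Set.range g) := fun j =>
    Ideal.pow_mem_of_pow_mem _ (hN0 j) ((Finset.single_le_sum (f := N0)
      (fun _ _ => Nat.zero_le _) (Finset.mem_univ j)).trans (Nat.le_add_left _ _))
  have hh : ∀ j, ∃ c : σ → MvPolynomial σ ℂ, (∀ i, (c i).IsHomogeneous (N - e)) ∧
      ∑ i, c i * g i = X j ^ N := by
    intro j
    obtain ⟨c, hc⟩ := Ideal.mem_span_range_iff_exists_fun.1 (hN j)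
    refine ⟨fun i => homogeneousComponent (N - e) (c i),
      fun i => homogeneousComponent_isHomogeneous _ _, ?_⟩
    have h1 := congrArg (homogeneousComponent N) hc
    rw [homogeneousComponent_eq_self (isHomogeneous_X_pow j N), map_sum] at h1
    rw [← h1]
    refine Finset.sum_congr rfl fun i _ => ?_
    have := DirectSum.coe_decompose_mul_of_right_mem_of_le (homogeneousSubmodule σ ℂ)
      (a := c i) (b := g i) (n := N) (hg i) (Nat.le_add_right _ _)
    have hd : ∀ (p : MvPolynomial σ ℂ) (k : ℕ),
        (DirectSum.decompose (homogeneousSubmodule σ ℂ) p k : MvPolynomial σ ℂ) =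
          homogeneousComponent k p := fun p k => decomposition.decompose'_apply p k
    rw [hd, hd] at this
    exact this.symm
  choose c hc hcs using hh
  refine aux_finite_of_reduction _ N (fun j => ∑ i, c j i * X i) (fun j => ?_) ?_
  · have : (∑ i, c j i * X i).IsHomogeneous (N - e + 1) :=
      IsHomogeneous.sum _ _ _ fun i _ => (hc j i).mul (isHomogeneous_X _ _)
    have h2 := this.totalDegree_le
    have : e ≤ N := Nat.le_add_right _ _
    omega
  · intro x hx j
    have := congrArg (eval x) (hcs j)
    simp only [map_sum, map_mul, map_pow, eval_X] at this ⊢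
    rw [← this]
    exact Finset.sum_congr rfl fun i _ => by rw [hx i]

theorem aux_eval_smul {σ : Type} [Fintype σ] {e : ℕ} {g : MvPolynomial σ ℂ}
    (hg : g.IsHomogeneous e) (t : ℂ) (x : σ → ℂ) :
    eval (t • x) g = t ^ e * eval x g := by
  rw [eval_eq', eval_eq', Finset.mul_sum]
  refine Finset.sum_congr rfl fun m hm => ?_
  have h := hg (mem_support_iff.1 hm)
  have h2 : ∑ i, m i = e := by
    rw [← h, Finsupp.weight_apply, Finsupp.sum_fintype _ _ (by simp)]; simp
  simp only [Pi.smul_apply, smul_eq_mul, mul_pow, Finset.prod_mul_distrib,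
    Finset.prod_pow_eq_pow_sum, h2]
  ring



/-- If `{f = 0}` is a smooth projective hypersurface of degree `d ≥ 3`, then `f` has only
finitely many isotropic eigenvectors up to scaling: the set of lines `ℂ·x` spanned by
nonzero `x` with `∑ᵢ xᵢ² = 0` and `∇f(x) = d·λ·x` for some `λ` is finite. -/
theorem smooth_hypersurface_finitely_many_isotropic_eigenvectors
    (n d : ℕ) (hd : 3 ≤ d)
    (f : MvPolynomial (Fin (n + 1)) ℂ) (hf : f.IsHomogeneous d)
    (hsmooth : ∀ x : Fin (n + 1) → ℂ, (∀ i, eval x (pderiv i f) = 0) → x = 0) :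
    ({W : Submodule ℂ (Fin (n + 1) → ℂ) | ∃ x : Fin (n + 1) → ℂ, x ≠ 0 ∧
        W = Submodule.span ℂ {x} ∧ (∑ i, (x i) ^ 2 = 0) ∧
        ∃ lam : ℂ, ∀ i, eval x (pderiv i f) = (d : ℂ) * lam * x i}).Finite := by
  have hfin := aux_reduction (d - 1) (by omega) (fun i => pderiv i f)
    (fun i => hf.pderiv) hsmooth
  refine (hfin.image fun x => Submodule.span ℂ {x}).subset ?_
  rintro W ⟨x, hx0, rfl, -, lam, hlam⟩
  have hc : (d : ℂ) * lam ≠ 0 := by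
    intro h
    exact hx0 (hsmooth x fun i => by rw [hlam, h, zero_mul])
  obtain ⟨t, ht⟩ := IsAlgClosed.exists_pow_nat_eq ((d : ℂ) * lam)⁻¹ (n := d - 2) (by omega)
  have ht0 : t ≠ 0 := by
    rintro rfl
    rw [zero_pow (by omega)] at ht
    exact inv_ne_zero hc ht.symm
  refine ⟨t • x, fun i => ?_, ?_⟩
  · rw [aux_eval_smul hf.pderiv, hlam, show d - 1 = d - 2 + 1 by omega, pow_succ, ht,
      Pi.smul_apply, smul_eq_mul]
    generalize (d : ℂ) * lam = c at hc
    field_simp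
  · exact Submodule.span_singleton_smul_eq (IsUnit.mk0 t ht0) x
end
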